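/- The pair (6; 0.864) is admissible: for every ε > 0 there exists M such that for every integer m ≥ M and every integer a with gcd(a,m) = 1, the class a modulo m is represented by a product of at most 6 primes, each at most m^{0.864+ε}. -/

import Mathlib

namespace St18

lemma two_mul_one_add (k : ℕ) (ε : ℝ) (hε : 0 < ε) :
    ((k:ℝ) + 1) ≤ (1 + 1 / (ε * Real.log 2)) * (2:ℝ) ^ (ε * k) := by
  have hl : 0 < Real.log 2 := Real.log_pos (by norm_num)
  have h1 : ε * Real.log 2 * k + 1 ≤ (2:ℝ) ^ (ε * k) := by
    rw [Real.rpow_def_of_pos (by norm_num)]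
    have := Real.add_one_le_exp (Real.log 2 * (ε * k))
    linarith
  have hp : 0 < ε * Real.log 2 := by positivity
  have h2 : (1:ℝ) ≤ (2:ℝ) ^ (ε * k) := Real.one_le_rpow (by norm_num) (by positivity)
  have h3 : (k:ℝ) ≤ 1 / (ε * Real.log 2) * (2:ℝ) ^ (ε * k) := by
    rw [div_mul_eq_mul_div, le_div_iff₀ hp]
    nlinarith
  linarith

lemma divisor_bound (ε : ℝ) (hε : 0 < ε) :
    ∃ C : ℝ, 1 ≤ C ∧ ∀ n : ℕ, 0 < n → (n.divisors.card : ℝ) ≤ C * (n:ℝ) ^ ε := by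
  set K : ℝ := 1 + 1 / (ε * Real.log 2) with hK
  have hl : 0 < Real.log 2 := Real.log_pos (by norm_num)
  have hK1 : 1 ≤ K := by
    rw [hK]; have : 0 < 1 / (ε * Real.log 2) := by positivity
    linarith
  obtain ⟨N, hN⟩ := exists_nat_ge ((2:ℝ) ^ (1/ε))
  refine ⟨K ^ N, one_le_pow₀ hK1, ?_⟩
  intro n hn
  have hn0 : n ≠ 0 := hn.ne'
  rw [Nat.card_divisors hn0]
  have e1 : (n:ℝ) ^ ε = ∏ p ∈ n.primeFactors, ((p:ℝ) ^ (n.factorization p)) ^ ε := by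
    conv_lhs => rw [← Nat.prod_factorization_pow_eq_self hn0]
    rw [Finsupp.prod, Nat.support_factorization]
    push_cast
    rw [Real.finsetProd_rpow]
    intro i _; positivity
  have e2 : ∏ p ∈ n.primeFactors, (if p < N then K else 1) ≤ K ^ N := by
    rw [Finset.prod_ite]
    simp only [Finset.prod_const, one_pow, mul_one]
    apply pow_le_pow_right₀ hK1
    calc _ ≤ (Finset.range N).card := Finset.card_le_card (by
            intro p hp; simp at hp ⊢; exact hp.2)
      _ = N := by simp
  have e3 : ((∏ p ∈ n.primeFactors, (n.factorization p + 1) : ℕ) : ℝ) ≤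
      ∏ p ∈ n.primeFactors, ((if p < N then K else 1) * ((p:ℝ) ^ (n.factorization p)) ^ ε) := by
    push_cast
    apply Finset.prod_le_prod
    · intro i _; positivity
    · intro p hp
      have hpp := Nat.prime_of_mem_primeFactors hp
      have hp2 : (2:ℝ) ≤ p := by exact_mod_cast hpp.two_le
      have hp0 : (0:ℝ) < p := by linarith
      set k := n.factorization p
      have e4 : ((p:ℝ) ^ k) ^ ε = (p:ℝ) ^ (ε * k) := by
        rw [← Real.rpow_natCast, ← Real.rpow_mul hp0.le]; ring_nf
      rw [e4]
      split_ifs with h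
      · refine (two_mul_one_add k ε hε).trans ?_
        gcongr
      · have h5 : (2:ℝ) ≤ (p:ℝ) ^ ε := by
          have : (2:ℝ) ^ (1/ε) ≤ p := hN.trans (by exact_mod_cast not_lt.mp h)
          calc (2:ℝ) = ((2:ℝ) ^ (1/ε)) ^ ε := by
                rw [← Real.rpow_mul (by norm_num)]; field_simp; simp
            _ ≤ _ := by gcongr
        rw [one_mul, Real.rpow_mul hp0.le, Real.rpow_natCast]
        calc (k:ℝ) + 1 ≤ 2 ^ k := by
              have := Nat.lt_two_pow_self (n := k)
              exact_mod_cast this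
          _ ≤ _ := by gcongr
  refine e3.trans ?_
  rw [Finset.prod_mul_distrib, ← e1]
  gcongr

lemma le_totient_mul_card_divisors (n : ℕ) (hn : 0 < n) : n ≤ n.totient * n.divisors.card := by
  conv_lhs => rw [← Nat.sum_totient n]
  calc _ ≤ ∑ d ∈ n.divisors, n.totient := by
        apply Finset.sum_le_sum
        intro d hd
        exact Nat.le_of_dvd (Nat.totient_pos.mpr hn) (Nat.totient_dvd_of_dvd (Nat.dvd_of_mem_divisors hd))
    _ = _ := by simp [mul_comm]

end St18


namespace St18

open Finset

lemma sum_zmod_eq (m : ℕ) [NeZero m] {M : Type*} [AddCommMonoid M] (f : ZMod m → M) :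
    ∑ a : ZMod m, f a = ∑ k ∈ range m, f (k : ZMod m) := by
  apply Finset.sum_bij' (fun (a : ZMod m) _ => a.val) (fun (k : ℕ) _ => (k : ZMod m))
  · intro a _; simp [ZMod.val_lt]
  · intro k _; simp
  · intro a _; simp
  · intro k hk; simp at hk; simp [ZMod.val_natCast, Nat.mod_eq_of_lt hk]
  · intro a _; simp

/-- Fourier coefficient of a character. -/
noncomputable def cc {m : ℕ} [NeZero m] (χ : DirichletCharacter ℂ m) (a : ZMod m) : ℂ :=
  ∑ b : ZMod m, χ b * ZMod.stdAddChar (a * b)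

lemma cc_zero {m : ℕ} [NeZero m] (χ : DirichletCharacter ℂ m) (h : χ ≠ 1) : cc χ 0 = 0 := by
  simp [cc, MulChar.sum_eq_zero_of_ne_one h]

lemma cc_unit {m : ℕ} [NeZero m] (χ : DirichletCharacter ℂ m) (u : (ZMod m)ˣ) (a : ZMod m) :
    ‖cc χ (u * a)‖ = ‖cc χ a‖ := by
  have h : cc χ a = χ u * cc χ (u * a) := by
    unfold cc
    rw [Finset.mul_sum]
    rw [← Equiv.sum_comp (Units.mulLeft u) (fun b => χ b * ZMod.stdAddChar (a * b))]
    apply Finset.sum_congr rfl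
    intro b _
    simp only [Units.mulLeft_apply, map_mul]
    rw [mul_assoc]
    congr 3
    ring
  rw [h, norm_mul, DirichletCharacter.unit_norm_eq_one, one_mul]

lemma parseval {m : ℕ} [NeZero m] (χ : DirichletCharacter ℂ m) :
    ∑ a : ZMod m, ‖cc χ a‖ ^ 2 ≤ (m:ℝ) * m := by
  have h1 : ((∑ a : ZMod m, ‖cc χ a‖ ^ 2 : ℝ) : ℂ) = ((m : ℝ) * ∑ b : ZMod m, ‖χ b‖ ^ 2 : ℝ) := by
    push_cast
    have : ∀ a : ZMod m, ((‖cc χ a‖ : ℂ)) ^ 2 =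
        ∑ b : ZMod m, ∑ b' : ZMod m, χ b * (starRingEnd ℂ) (χ b') * ZMod.stdAddChar (a * (b - b')) := by
      intro a
      rw [← Complex.mul_conj']
      unfold cc
      rw [map_sum, Finset.sum_mul_sum]
      refine Finset.sum_congr rfl fun b _ => Finset.sum_congr rfl fun b' _ => ?_
      rw [map_mul (starRingEnd ℂ), ← AddChar.map_neg_eq_conj, mul_sub, sub_eq_add_neg, AddChar.map_add_eq_mul]
      ring
    simp_rw [this]
    rw [Finset.sum_comm]
    rw [Finset.mul_sum]
    refine Finset.sum_congr rfl fun b _ => ?_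
    rw [Finset.sum_comm]
    simp_rw [← Finset.mul_sum]
    simp_rw [AddChar.sum_mulShift _ (ZMod.isPrimitive_stdAddChar m)]
    rw [Finset.sum_eq_single b]
    · rw [← Complex.mul_conj']; simp; ring
    · intro b' _ hb; rw [if_neg]; · simp
      intro h; exact hb (sub_eq_zero.mp h).symm
    · simp
  have h2 := Complex.ofReal_injective h1
  rw [h2]
  gcongr
  calc ∑ b : ZMod m, ‖χ b‖ ^ 2 ≤ ∑ b : ZMod m, (1:ℝ) := by
        apply Finset.sum_le_sum
        intro b _
        exact pow_le_one₀ (norm_nonneg _) (χ.norm_le_one b)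
    _ = m := by simp [ZMod.card]

lemma card_ker (m k : ℕ) [NeZero m] :
    #{v : ZMod m | v * (k : ZMod m) = 0} ≤ Nat.gcd k m := by
  have hm : 0 < m := Nat.pos_of_ne_zero (NeZero.ne m)
  have hg : 0 < Nat.gcd k m := Nat.gcd_pos_of_pos_right _ hm
  obtain ⟨m', hm'⟩ := Nat.gcd_dvd_right k m
  set g := Nat.gcd k m with hgd
  have hm'0 : 0 < m' := by
    rcases Nat.eq_zero_or_pos m' with h | h
    · subst h; omega
    · exact h
  rw [← Finset.card_range g]
  apply Finset.card_le_card_of_injOn (fun v => v.val / m')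
  · intro v _
    simp only [coe_range, Set.mem_Iio]
    rw [Nat.div_lt_iff_lt_mul hm'0, ← hm']
    exact ZMod.val_lt v
  · intro v hv w hw h
    have key : ∀ v : ZMod m, v * (k : ZMod m) = 0 → m' ∣ v.val := by
      intro v hv
      have : ((v.val * k : ℕ) : ZMod m) = 0 := by push_cast; simpa using hv
      rw [ZMod.natCast_eq_zero_iff] at this
      obtain ⟨k', hk'⟩ := Nat.gcd_dvd_left k m
      rw [← hgd] at hk'
      have hc : Nat.Coprime m' k' := by
        have := Nat.coprime_div_gcd_div_gcd (m := k) (n := m) hg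
        rw [← hgd] at this
        rw [Nat.div_eq_of_eq_mul_right hg hk', Nat.div_eq_of_eq_mul_right hg hm'] at this
        exact this.symm
      generalize v.val = w at this ⊢
      rw [hk', hm', show w * (g * k') = g * (w * k') by ring] at this
      exact hc.dvd_of_dvd_mul_right (Nat.dvd_of_mul_dvd_mul_left hg this)
    simp only [coe_filter, mem_univ, true_and, Set.mem_ofPred_eq] at hv hw
    apply ZMod.val_injective
    rw [← Nat.div_mul_cancel (key v hv), ← Nat.div_mul_cancel (key w hw)]
    simp only at h
    rw [h]

lemma cc_bound {m : ℕ} [NeZero m] (χ : DirichletCharacter ℂ m) (k : ℕ) :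
    ‖cc χ k‖ ^ 2 ≤ (Nat.gcd k m : ℝ) * m * m.divisors.card := by
  classical
  have hm : 0 < m := Nat.pos_of_ne_zero (NeZero.ne m)
  have h1 : ∑ u : (ZMod m)ˣ, ‖cc χ (u * (k : ZMod m))‖ ^ 2 = m.totient * ‖cc χ k‖ ^ 2 := by
    simp_rw [cc_unit]
    simp [ZMod.card_units_eq_totient]
  have h2 : ∑ u : (ZMod m)ˣ, ‖cc χ (u * (k : ZMod m))‖ ^ 2 ≤ (Nat.gcd k m : ℝ) * ∑ b : ZMod m, ‖cc χ b‖ ^ 2 := by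
    rw [← Finset.sum_fiberwise univ (fun u : (ZMod m)ˣ => (u : ZMod m) * (k : ZMod m)), Finset.mul_sum]
    apply Finset.sum_le_sum
    intro b _
    have : ∑ u ∈ (univ : Finset (ZMod m)ˣ) with ((u : (ZMod m)ˣ) : ZMod m) * (k : ZMod m) = b, ‖cc χ (u * (k : ZMod m))‖ ^ 2
        = #{u : (ZMod m)ˣ | (u : ZMod m) * (k : ZMod m) = b} * ‖cc χ b‖ ^ 2 := by
      rw [Finset.sum_congr rfl (g := fun _ => ‖cc χ b‖ ^ 2)]
      · simp
      · intro u hu; simp at hu; rw [hu]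
    rw [this]
    gcongr
    rcases Finset.eq_empty_or_nonempty ({u : (ZMod m)ˣ | (u : ZMod m) * (k : ZMod m) = b} : Finset _) with h | ⟨u0, hu0⟩
    · rw [h]; simp
    · refine le_trans ?_ (card_ker m k)
      apply Finset.card_le_card_of_injOn (fun (u : (ZMod m)ˣ) => (u : ZMod m) - u0)
      · intro u hu
        simp at hu hu0 ⊢
        rw [sub_mul, hu, hu0, sub_self]
      · intro u _ v _ h
        simp at h
        exact Units.ext h
  have h3 := parseval χ
  have h4 : (m:ℝ) ≤ m.totient * m.divisors.card := by exact_mod_cast le_totient_mul_card_divisors m hm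
  have ht : (0:ℝ) < m.totient := by exact_mod_cast Nat.totient_pos.mpr hm
  have h5 : (m.totient:ℝ) * ‖cc χ k‖ ^ 2 ≤ m.totient * ((Nat.gcd k m : ℝ) * m * m.divisors.card) := by
    rw [← h1]
    refine h2.trans ?_
    calc (Nat.gcd k m : ℝ) * ∑ b : ZMod m, ‖cc χ b‖ ^ 2 ≤ (Nat.gcd k m : ℝ) * (m * (m.totient * m.divisors.card)) := by
          gcongr
          exact h3.trans (by gcongr)
      _ = _ := by ring
  exact le_of_mul_le_mul_left h5 ht

lemma sin_lower (m k : ℕ) (hk : 0 < k) (hkm : k < m) :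
    1 / Real.sin (Real.pi * k / m) ≤ m / 2 * (1 / k + 1 / (m - k : ℝ)) := by
  have hm : (0:ℝ) < m := by exact_mod_cast (by omega : 0 < m)
  have hk0 : (0:ℝ) < k := by exact_mod_cast hk
  have hkm' : (0:ℝ) < m - k := by
    have : (k:ℝ) < m := by exact_mod_cast hkm
    linarith
  have hpi := Real.pi_pos
  have main : ∀ j : ℝ, 0 < j → j ≤ m / 2 → 1 / Real.sin (Real.pi * j / m) ≤ m / 2 * (1 / j) := by
    intro j hj hj2
    have := Real.mul_le_sin (x := Real.pi * j / m) (by positivity) (by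
      rw [div_le_div_iff₀ hm (by norm_num)]; nlinarith)
    have e : 2 / Real.pi * (Real.pi * j / m) = 2 * j / m := by field_simp
    rw [e] at this
    have h2 : 0 < 2 * j / m := by positivity
    calc 1 / Real.sin (Real.pi * j / m) ≤ 1 / (2 * j / m) := by gcongr
      _ = _ := by field_simp
  rcases le_total (k:ℝ) (m/2) with h | h
  · refine (main k hk0 h).trans ?_
    have : 0 < 1 / (m - k:ℝ) := by positivity
    gcongr; linarith
  · have := main (m - k) hkm' (by linarith)
    have e : Real.pi * (m - k) / m = Real.pi - Real.pi * k / m := by field_simp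
    rw [e, Real.sin_pi_sub] at this
    refine this.trans ?_
    have : 0 < 1 / (k:ℝ) := by positivity
    gcongr; linarith

lemma geom_bound {m : ℕ} [NeZero m] (k N : ℕ) (hk : 0 < k) (hkm : k < m) :
    ‖∑ n ∈ Icc 1 N, (ZMod.stdAddChar (-((k : ZMod m) * (n : ZMod m))) : ℂ)‖
      ≤ m / 2 * (1 / k + 1 / (m - k : ℝ)) := by
  have hm : (0:ℝ) < m := by exact_mod_cast (by omega : 0 < m)
  set ζ : ℂ := ZMod.stdAddChar (k : ZMod m) with hζ
  have e0 : ‖∑ n ∈ Icc 1 N, (ZMod.stdAddChar (-((k : ZMod m) * (n : ZMod m))) : ℂ)‖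
     = ‖∑ n ∈ range N, ζ ^ n‖ := by
    simp_rw [AddChar.map_neg_eq_conj]
    rw [← map_sum, Complex.norm_conj]
    have : ∀ n : ℕ, (ZMod.stdAddChar ((k : ZMod m) * (n : ZMod m)) : ℂ) = ζ ^ n := by
      intro n
      rw [hζ, ← AddChar.map_nsmul_eq_pow, nsmul_eq_mul, mul_comm]
    simp_rw [this]
    rw [Finset.range_eq_Ico, ← Finset.Ico_add_one_right_eq_Icc, Finset.sum_Ico_eq_sum_range]
    simp only [Nat.add_sub_cancel, pow_add, pow_one]
    rw [← Finset.mul_sum, norm_mul, hζ, AddChar.norm_apply, one_mul, Finset.range_eq_Ico]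
  have e1 : ‖ζ - 1‖ = 2 * Real.sin (Real.pi * k / m) := by
    have : ζ = Complex.exp (Complex.I * ((2 * Real.pi * k / m : ℝ) : ℂ)) := by
      rw [hζ]
      have := ZMod.stdAddChar_coe (N := m) (k : ℤ)
      push_cast at this
      rw [this]
      congr 1
      push_cast; ring
    rw [this, Complex.norm_exp_I_mul_ofReal_sub_one, Real.norm_of_nonneg]
    · congr 2; ring
    · have : 0 ≤ Real.sin (2 * Real.pi * k / m / 2) := by
        apply Real.sin_nonneg_of_nonneg_of_le_pi
        · positivity
        · have : (k:ℝ) ≤ m := by exact_mod_cast hkm.le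
          rw [div_div, div_le_iff₀ (by positivity)]
          nlinarith [Real.pi_pos]
      linarith
  have hsin : 0 < Real.sin (Real.pi * k / m) := by
    apply Real.sin_pos_of_pos_of_lt_pi
    · have : (0:ℝ) < k := by exact_mod_cast hk
      positivity
    · have : (k:ℝ) < m := by exact_mod_cast hkm
      rw [div_lt_iff₀ hm]
      nlinarith [Real.pi_pos]
  have hne : ζ ≠ 1 := by
    intro h; rw [h] at e1; simp at e1; linarith
  rw [e0, geom_sum_eq hne, norm_div, e1]
  refine le_trans ?_ (sin_lower m k hk hkm)
  have : ‖ζ ^ N - 1‖ ≤ 2 := by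
    calc ‖ζ ^ N - 1‖ ≤ ‖ζ ^ N‖ + ‖(1:ℂ)‖ := norm_sub_le _ _
      _ = 2 := by rw [norm_pow, hζ, AddChar.norm_apply]; norm_num
  rw [div_le_div_iff₀ (by positivity) hsin]
  nlinarith

lemma sum_gcd_div (m : ℕ) (hm : 0 < m) :
    ∑ k ∈ Ico 1 m, (Nat.gcd k m : ℝ) / k ≤ m.divisors.card * (1 + Real.log m) := by
  calc ∑ k ∈ Ico 1 m, (Nat.gcd k m : ℝ) / k 
      ≤ ∑ k ∈ Ico 1 m, ∑ g ∈ m.divisors, if g ∣ k then (g:ℝ) / k else 0 := by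
        apply Finset.sum_le_sum
        intro k hk
        have := Finset.single_le_sum (s := m.divisors) (f := fun g => if g ∣ k then (g:ℝ) / k else 0)
          (fun i _ => by positivity) (a := Nat.gcd k m) (by simp [Nat.gcd_dvd_right, hm.ne'])
        simpa [Nat.gcd_dvd_left] using this
    _ = ∑ g ∈ m.divisors, ∑ k ∈ Ico 1 m, if g ∣ k then (g:ℝ) / k else 0 := Finset.sum_comm
    _ ≤ ∑ g ∈ m.divisors, (1 + Real.log m) := by
        apply Finset.sum_le_sum
        intro g hg
        have hg0 : 0 < g := Nat.pos_of_mem_divisors hg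
        refine le_trans ?_ (harmonic_le_one_add_log m)
        rw [harmonic_eq_sum_Icc]
        push_cast
        rw [← Finset.sum_filter]
        have : ∑ k ∈ (Ico 1 m).filter (g ∣ ·), (g:ℝ) / k = ∑ j ∈ ((Ico 1 m).filter (g ∣ ·)).image (· / g), ((j:ℝ))⁻¹ := by
          rw [Finset.sum_image]
          · apply Finset.sum_congr rfl
            intro k hk
            simp at hk
            rw [Nat.cast_div hk.2 (by positivity)]
            rw [inv_div]
          · intro a ha b hb h
            simp at ha hb h
            exact (Nat.div_left_inj ha.2 hb.2).mp h
        rw [this]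
        apply Finset.sum_le_sum_of_subset_of_nonneg
        · intro j hj
          simp at hj ⊢
          obtain ⟨k, ⟨⟨h1, h2⟩, h3⟩, rfl⟩ := hj
          constructor
          · exact Nat.div_pos (Nat.le_of_dvd h1 h3) hg0
          · exact (Nat.div_le_self _ _).trans h2.le
        · intros; positivity
    _ = _ := by simp; ring

theorem polya {m : ℕ} [NeZero m] (χ : DirichletCharacter ℂ m) (hχ : χ ≠ 1) (N : ℕ) :
    ‖∑ n ∈ Icc 1 N, χ (n : ZMod m)‖ ≤ Real.sqrt m * (m.divisors.card : ℝ) ^ 2 * (1 + Real.log m) := by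
  have hm : 0 < m := Nat.pos_of_ne_zero (NeZero.ne m)
  have hm' : (0:ℝ) < m := by exact_mod_cast hm
  have e1 : (m : ℂ) * ∑ n ∈ Icc 1 N, χ (n : ZMod m) = ∑ k ∈ range m, cc χ k *
      ∑ n ∈ Icc 1 N, (ZMod.stdAddChar (-((k : ZMod m) * (n : ZMod m))) : ℂ) := by
    rw [← sum_zmod_eq m (fun a => cc χ a * ∑ n ∈ Icc 1 N, (ZMod.stdAddChar (-(a * (n : ZMod m))) : ℂ))]
    simp_rw [Finset.mul_sum]
    rw [Finset.sum_comm]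
    refine Finset.sum_congr rfl fun n _ => ?_
    have : ∀ a : ZMod m, cc χ a * (ZMod.stdAddChar (-(a * (n : ZMod m))) : ℂ) =
        ∑ b : ZMod m, χ b * ZMod.stdAddChar (a * (b - (n : ZMod m))) := by
      intro a
      rw [cc, Finset.sum_mul]
      refine Finset.sum_congr rfl fun b _ => ?_
      rw [mul_sub, sub_eq_add_neg, AddChar.map_add_eq_mul]; ring
    simp_rw [this]
    rw [Finset.sum_comm]
    simp_rw [← Finset.mul_sum]
    simp_rw [AddChar.sum_mulShift _ (ZMod.isPrimitive_stdAddChar m)]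
    rw [Finset.sum_eq_single (n : ZMod m)]
    · simp; ring
    · intro b _ hb; rw [if_neg]; · simp
      intro h; exact hb (sub_eq_zero.mp h)
    · simp
  set τ : ℝ := (m.divisors.card : ℝ) with hτ
  have hτ1 : 1 ≤ τ := by
    rw [hτ]; exact_mod_cast Finset.card_pos.mpr ⟨1, by simp [hm.ne']⟩
  have hb : ∀ k ∈ Ico 1 m, ‖cc χ k *
      ∑ n ∈ Icc 1 N, (ZMod.stdAddChar (-((k : ZMod m) * (n : ZMod m))) : ℂ)‖ ≤
      Real.sqrt m * τ * (m / 2) * ((Nat.gcd k m : ℝ) / k + (Nat.gcd (m - k) m : ℝ) / ((m - k : ℕ) : ℝ)) := by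
    intro k hk
    simp at hk
    have hg : (1:ℝ) ≤ Nat.gcd k m := by exact_mod_cast Nat.gcd_pos_of_pos_right _ hm
    have h1 : ‖cc χ k‖ ≤ Real.sqrt m * τ * Nat.gcd k m := by
      refine (sq_le_sq₀ (norm_nonneg _) (by positivity)).mp ?_
      refine (cc_bound χ k).trans ?_
      rw [mul_pow, mul_pow, Real.sq_sqrt hm'.le]
      nlinarith [mul_le_mul hτ1 hg (by norm_num) (by linarith), mul_pos hm' (by positivity : 0 < τ * Nat.gcd k m)]
    have h2 := geom_bound (m := m) k N (by omega) hk.2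
    rw [norm_mul]
    calc _ ≤ Real.sqrt m * τ * Nat.gcd k m * (m / 2 * (1 / k + 1 / (m - k : ℝ))) := by gcongr
      _ = _ := by
        rw [Nat.gcd_comm (m - k), Nat.gcd_self_sub_right hk.2.le, Nat.gcd_comm m k, Nat.cast_sub hk.2.le]; ring
  have h3 : (m:ℝ) * ‖∑ n ∈ Icc 1 N, χ (n : ZMod m)‖ ≤ 
      m * (Real.sqrt m * τ ^ 2 * (1 + Real.log m)) := by
    have : (m:ℝ) * ‖∑ n ∈ Icc 1 N, χ (n : ZMod m)‖ = ‖(m : ℂ) * ∑ n ∈ Icc 1 N, χ (n : ZMod m)‖ := by simp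
    rw [this, e1, Finset.range_eq_Ico, ← Finset.sum_Ioo_add_eq_sum_Ico hm]
    simp only [Nat.cast_zero, cc_zero χ hχ, zero_mul, add_zero]
    rw [show Ioo 0 m = Ico 1 m by ext; simp; omega]
    refine (norm_sum_le _ _).trans ((Finset.sum_le_sum hb).trans ?_)
    rw [← Finset.mul_sum, Finset.sum_add_distrib]
    have e2 : ∑ k ∈ Ico 1 m, (Nat.gcd (m - k) m : ℝ) / ((m - k : ℕ) : ℝ) = ∑ k ∈ Ico 1 m, (Nat.gcd k m : ℝ) / k := by
      apply Finset.sum_bij' (fun k _ => m - k) (fun k _ => m - k)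
      · intro k hk; simp at hk ⊢; omega
      · intro k hk; simp at hk ⊢; omega
      · intro k hk; simp at hk ⊢; omega
      · intro k hk; simp at hk ⊢; omega
      · intro k hk; rfl
    rw [e2]
    have := sum_gcd_div m hm
    rw [← hτ] at this
    calc _ = Real.sqrt m * τ * m * (∑ k ∈ Ico 1 m, (Nat.gcd k m : ℝ) / k) := by ring
      _ ≤ Real.sqrt m * τ * m * (τ * (1 + Real.log m)) := by gcongr
      _ = _ := by ring
  exact le_of_mul_le_mul_left h3 hm'

end St18


namespace St18

open Finset

lemma log_div_sum_bdd : ∃ C : ℝ, 0 < C ∧ ∀ S : Finset ℕ, (∀ p ∈ S, 2 ≤ p) →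
    ∑ p ∈ S, Real.log p / (p * (p - 1)) ≤ C := by
  have hs : Summable (fun n : ℕ => 4 * (1 / (n:ℝ) ^ (3/2 : ℝ))) :=
    (Real.summable_one_div_nat_rpow.mpr (by norm_num)).mul_left 4
  refine ⟨∑' n : ℕ, 4 * (1 / (n:ℝ) ^ (3/2 : ℝ)) + 1, ?_, ?_⟩
  · have : 0 ≤ ∑' n : ℕ, 4 * (1 / (n:ℝ) ^ (3/2 : ℝ)) := tsum_nonneg (fun n => by positivity)
    linarith
  · intro S hS
    have : ∑ p ∈ S, Real.log p / (p * (p - 1)) ≤ ∑ p ∈ S, 4 * (1 / (p:ℝ) ^ (3/2 : ℝ)) := by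
      apply Finset.sum_le_sum
      intro p hp
      have hp2 : (2:ℝ) ≤ p := by exact_mod_cast hS p hp
      have hp0 : (0:ℝ) < p := by linarith
      have h1 : Real.log p ≤ (p:ℝ) ^ (1/2 : ℝ) / (1/2) := Real.log_le_rpow_div hp0.le (by norm_num)
      have h2 : (p:ℝ) ^ (1/2 : ℝ) * (p:ℝ) ^ (3/2 : ℝ) = p * p := by
        rw [← Real.rpow_add hp0]; norm_num; ring
      have h3 : 0 < (p:ℝ) ^ (3/2 : ℝ) := by positivity
      rw [mul_one_div, div_le_div_iff₀ (by nlinarith) h3]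
      calc Real.log p * (p:ℝ) ^ (3/2 : ℝ) ≤ (p:ℝ) ^ (1/2 : ℝ) / (1/2) * (p:ℝ) ^ (3/2 : ℝ) := by gcongr
        _ = 2 * (p * p) := by rw [div_mul_eq_mul_div, h2]; ring
        _ ≤ _ := by nlinarith
    have h2 := hs.sum_le_tsum S (fun n _ => by positivity)
    linarith

/-- primes up to `n` -/
abbrev pr (n : ℕ) : Finset ℕ := (Icc 1 n).filter Nat.Prime

lemma log_factorial_eq (n : ℕ) :
    Real.log (n.factorial) = ∑ p ∈ pr n, (padicValNat p n.factorial : ℝ) * Real.log p := by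
  rw [Real.log_nat_eq_sum_factorization, Finsupp.sum]
  have : (n.factorial.factorization).support = pr n := by
    ext p
    simp only [Nat.support_factorization, Nat.mem_primeFactors, mem_filter, mem_Icc]
    constructor
    · rintro ⟨h1, h2, _⟩
      exact ⟨⟨h1.one_le, h1.dvd_factorial.mp h2⟩, h1⟩
    · rintro ⟨⟨_, h1⟩, h2⟩
      exact ⟨h2, h2.dvd_factorial.mpr h1, Nat.factorial_ne_zero _⟩
  rw [this]
  apply Finset.sum_congr rfl
  intro p hp
  simp at hp
  rw [Nat.factorization_def _ hp.2]

lemma mertens_lower (n : ℕ) (hn : 0 < n) :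
    Real.log n - 1 ≤ ∑ p ∈ pr n, Real.log p / (p - 1) := by
  have hn' : (0:ℝ) < n := by exact_mod_cast hn
  have h1 : n * Real.log n - n ≤ Real.log (n.factorial) := by
    have h0 := Real.exp_pos (n:ℝ)
    have : (n:ℝ) ^ n / Real.exp n ≤ n.factorial := by
      rw [div_le_iff₀ h0]
      have := Real.pow_div_factorial_le_exp (n:ℝ) hn'.le n
      rw [div_le_iff₀ (by positivity)] at this
      linarith
    have := Real.log_le_log (by positivity) this
    rwa [Real.log_div (by positivity) (by positivity), Real.log_pow, Real.log_exp] at this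
  have h2 : Real.log (n.factorial) ≤ n * ∑ p ∈ pr n, Real.log p / (p - 1) := by
    rw [log_factorial_eq, Finset.mul_sum]
    apply Finset.sum_le_sum
    intro p hp
    simp at hp
    have : Fact p.Prime := ⟨hp.2⟩
    have h3 := sub_one_mul_padicValNat_factorial (p := p) n
    have h4 : (p - 1) * padicValNat p n.factorial ≤ n := by omega
    have h5 : ((p:ℝ) - 1) * padicValNat p n.factorial ≤ n := by
      have : ((p - 1 : ℕ) : ℝ) = p - 1 := by rw [Nat.cast_sub hp.2.one_le]; simp
      rw [← this]; exact_mod_cast h4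
    have hp2 : (2:ℝ) ≤ p := by exact_mod_cast hp.2.two_le
    have hl : 0 ≤ Real.log p := Real.log_nonneg (by linarith)
    rw [mul_div_assoc', le_div_iff₀ (by linarith)]
    nlinarith
  have h6 : n * (Real.log n - 1) ≤ n * ∑ p ∈ pr n, Real.log p / (p - 1) := by
    linarith
  exact le_of_mul_le_mul_left h6 hn'

lemma mertens_upper (n : ℕ) (hn : 0 < n) :
    ∑ p ∈ pr n, Real.log p / p ≤ Real.log n + Real.log 4 := by
  have hn' : (0:ℝ) < n := by exact_mod_cast hn
  have h1 : Real.log (n.factorial) ≤ n * Real.log n := by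
    rw [← Real.log_pow]
    apply Real.log_le_log (by positivity)
    exact_mod_cast Nat.factorial_le_pow n
  have h2 : n * ∑ p ∈ pr n, Real.log p / p - Chebyshev.theta n ≤ Real.log (n.factorial) := by
    rw [log_factorial_eq, Finset.mul_sum, Chebyshev.theta_eq_sum_Icc]
    have e : ({p ∈ Icc 0 ⌊(n:ℝ)⌋₊ | Nat.Prime p} : Finset ℕ) = pr n := by
      ext p; simp; intro h; intro; exact h.one_le
    rw [e, ← Finset.sum_sub_distrib]
    apply Finset.sum_le_sum
    intro p hp
    simp at hp
    have : Fact p.Prime := ⟨hp.2⟩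
    have h3 : n / p ≤ padicValNat p n.factorial := by
      rw [padicValNat_factorial (p := p) (n := n) (b := Nat.log p n + 2) (by omega)]
      have := Finset.single_le_sum (s := Ico 1 (Nat.log p n + 2)) (f := fun i => n / p ^ i) (fun _ _ => by positivity)
        (a := 1) (by simp)
      simpa using this
    have h4 : (n:ℝ) / p - 1 ≤ padicValNat p n.factorial := by
      have := Nat.lt_floor_add_one ((n:ℝ) / p)
      rw [Nat.floor_div_natCast, Nat.floor_natCast] at this
      have h5 : ((n / p : ℕ) : ℝ) ≤ padicValNat p n.factorial := by exact_mod_cast h3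
      linarith
    have hp2 : (2:ℝ) ≤ p := by exact_mod_cast hp.2.two_le
    have hl : 0 ≤ Real.log p := Real.log_nonneg (by linarith)
    calc _ = ((n:ℝ) / p - 1) * Real.log p := by ring
      _ ≤ _ := by gcongr
  have h3 := Chebyshev.theta_le_log4_mul_x hn'.le
  have h6 : n * ∑ p ∈ pr n, Real.log p / p ≤ n * (Real.log n + Real.log 4) := by linarith
  exact le_of_mul_le_mul_left h6 hn'

lemma mertens : ∃ C : ℝ, 1 ≤ C ∧ ∀ N : ℕ, 0 < N → ∀ s : ℝ, 0 ≤ s → s ≤ Real.log N →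
    |∑ p ∈ (pr N).filter (fun p : ℕ => Real.log p ≤ s), Real.log p / p - s| ≤ C ∧
    |∑ p ∈ (pr N).filter (fun p : ℕ => Real.log p ≤ s), Real.log p / (p - 1) - s| ≤ C := by
  obtain ⟨C, hC, hb⟩ := log_div_sum_bdd
  have h4 := Real.log_nonneg (show (1:ℝ) ≤ 4 by norm_num)
  have h2 := Real.log_nonneg (show (1:ℝ) ≤ 2 by norm_num)
  refine ⟨C + Real.log 4 + 1 + Real.log 2, by linarith, ?_⟩
  intro N hN s hs hsN
  set n := ⌊Real.exp s⌋₊ with hn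
  have h1 : 1 ≤ Real.exp s := Real.one_le_exp hs
  have hn1 : 1 ≤ n := by rw [hn]; exact Nat.le_floor (by simpa using h1)
  have hn0 : (0:ℝ) < n := by exact_mod_cast hn1
  have hN0 : (0:ℝ) < N := by exact_mod_cast hN
  have hnN : n ≤ N := by
    rw [hn]
    apply Nat.floor_le_of_le
    rwa [← Real.le_log_iff_exp_le hN0]
  have e : (pr N).filter (fun p : ℕ => Real.log p ≤ s) = pr n := by
    ext p
    simp only [mem_filter, mem_Icc]
    constructor
    · rintro ⟨⟨⟨h1, h2⟩, h3⟩, h4⟩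
      refine ⟨⟨h1, ?_⟩, h3⟩
      rw [hn]
      apply Nat.le_floor
      rwa [← Real.log_le_iff_le_exp (by exact_mod_cast h1)]
    · rintro ⟨⟨h1, h2⟩, h3⟩
      refine ⟨⟨⟨h1, h2.trans hnN⟩, h3⟩, ?_⟩
      rw [Real.log_le_iff_le_exp (by exact_mod_cast h1)]
      refine le_trans (by exact_mod_cast h2) (Nat.floor_le (by positivity))
  rw [e]
  have hup : Real.log n ≤ s := by
    rw [Real.log_le_iff_le_exp hn0]; exact Nat.floor_le (by positivity)
  have hlo : s ≤ Real.log n + Real.log 2 := by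
    rw [← Real.log_mul (by positivity) (by norm_num), Real.le_log_iff_exp_le (by positivity)]
    have : Real.exp s < n + 1 := Nat.lt_floor_add_one _
    have : (1:ℝ) ≤ n := by exact_mod_cast hn1
    linarith
  have hdiff : ∑ p ∈ pr n, Real.log p / ((p:ℝ) - 1) - ∑ p ∈ pr n, Real.log p / p ≤ C := by
    rw [← Finset.sum_sub_distrib]
    refine le_trans (le_of_eq ?_) (hb (pr n) ?_)
    · apply Finset.sum_congr rfl
      intro p hp
      simp at hp
      have hp2 : (2:ℝ) ≤ p := by exact_mod_cast hp.2.two_le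
      have : (p:ℝ) - 1 ≠ 0 := by linarith
      have : (p:ℝ) ≠ 0 := by linarith
      field_simp
      ring
    · intro p hp; simp at hp; exact hp.2.two_le
  have hle : ∑ p ∈ pr n, Real.log p / (p:ℝ) ≤ ∑ p ∈ pr n, Real.log p / ((p:ℝ) - 1) := by
    apply Finset.sum_le_sum
    intro p hp
    simp at hp
    have hp2 : (2:ℝ) ≤ p := by exact_mod_cast hp.2.two_le
    have := Real.log_nonneg (show (1:ℝ) ≤ p by linarith)
    apply div_le_div_of_nonneg_left this (by linarith) (by linarith)
  have ha := mertens_lower n hn1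
  have hb := mertens_upper n hn1
  constructor <;> rw [abs_le] <;> constructor <;> linarith

lemma abel (S : Finset ℕ) (a u : ℕ → ℝ) (T0 T C : ℝ) (hT : T0 ≤ T) (f f' F g G : ℝ → ℝ)
    (hf : ∀ s ∈ Set.Icc T0 T, HasDerivAt f (f' s) s) (hc : ContinuousOn f' (Set.Icc T0 T))
    (hF : ∀ s ∈ Set.Icc T0 T, HasDerivAt F (f s) s)
    (hG : ∀ s ∈ Set.Icc T0 T, HasDerivAt G (g s) s) (hgc : ContinuousOn g (Set.Icc T0 T))
    (hg : ∀ s ∈ Set.Icc T0 T, |f' s| ≤ g s)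
    (hu : ∀ i ∈ S, T0 < u i ∧ u i ≤ T)
    (hA : ∀ s ∈ Set.Icc T0 T, |∑ i ∈ S.filter (fun i => u i ≤ s), a i - (s - T0)| ≤ C) :
    ∑ i ∈ S, a i * f (u i) ≤ F T - F T0 + C * (|f T| + (G T - G T0)) := by
  have huIcc : Set.uIcc T0 T = Set.Icc T0 T := Set.uIcc_of_le hT
  have hC : 0 ≤ C := (abs_nonneg _).trans (hA T ⟨hT, le_refl _⟩)
  have hi' : IntervalIntegrable f' MeasureTheory.volume T0 T := by
    apply ContinuousOn.intervalIntegrable; rwa [huIcc]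
  have hig : IntervalIntegrable g MeasureTheory.volume T0 T := by
    apply ContinuousOn.intervalIntegrable; rwa [huIcc]
  have hfc : ContinuousOn f (Set.Icc T0 T) := fun s hs => (hf s hs).continuousAt.continuousWithinAt
  have hif : IntervalIntegrable f MeasureTheory.volume T0 T := by
    apply ContinuousOn.intervalIntegrable; rwa [huIcc]
  have eF : ∫ s in T0..T, f s = F T - F T0 :=
    intervalIntegral.integral_eq_sub_of_hasDerivAt (by rwa [huIcc]) hif
  have eG : ∫ s in T0..T, g s = G T - G T0 :=
    intervalIntegral.integral_eq_sub_of_hasDerivAt (by rwa [huIcc]) hig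
  have hic : IntervalIntegrable (fun s => f' s * (s - T0)) MeasureTheory.volume T0 T := by
    apply ContinuousOn.intervalIntegrable; rw [huIcc]
    exact hc.mul (by fun_prop)
  have eP : ∫ s in T0..T, (f' s * (s - T0) + f s * 1) = f T * (T - T0) - f T0 * (T0 - T0) := by
    apply intervalIntegral.integral_eq_sub_of_hasDerivAt (f := fun s => f s * (s - T0))
    · rw [huIcc]; intro s hs
      exact (hf s hs).mul ((hasDerivAt_id s).sub_const T0)
    · simp only [mul_one]; exact hic.add hif
  simp only [mul_one] at eP
  rw [intervalIntegral.integral_add hic hif, eF] at eP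
  -- indicator form
  have hind : ∀ i ∈ S, IntervalIntegrable (fun s => a i * (Set.Ici (u i)).indicator f' s) MeasureTheory.volume T0 T := by
    intro i _
    apply IntervalIntegrable.const_mul
    rw [intervalIntegrable_iff_integrableOn_Ioc_of_le hT] at hi' ⊢
    exact hi'.indicator measurableSet_Ici
  have hpt : ∀ i ∈ S, a i * f (u i) = a i * f T - ∫ s in T0..T, a i * (Set.Ici (u i)).indicator f' s := by
    intro i hi
    obtain ⟨h1, h2⟩ := hu i hi
    rw [intervalIntegral.integral_const_mul, intervalIntegral.integral_of_le hT,
      MeasureTheory.setIntegral_indicator measurableSet_Ici]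
    have : Set.Ioc T0 T ∩ Set.Ici (u i) = Set.Icc (u i) T := by
      ext s; simp; constructor
      · rintro ⟨⟨_, h⟩, h'⟩; exact ⟨h', h⟩
      · rintro ⟨h', h⟩; exact ⟨⟨by linarith, h⟩, h'⟩
    rw [this, MeasureTheory.integral_Icc_eq_integral_Ioc, ← intervalIntegral.integral_of_le h2,
      intervalIntegral.integral_eq_sub_of_hasDerivAt (f := f)]
    · ring
    · rw [Set.uIcc_of_le h2]; intro s hs; exact hf s ⟨by linarith [hs.1], hs.2⟩
    · apply hi'.mono_set; rw [huIcc, Set.uIcc_of_le h2]; exact Set.Icc_subset_Icc_left h1.le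
  set A : ℝ → ℝ := fun s => ∑ i ∈ S.filter (fun i => u i ≤ s), a i with hAd
  have hsum : ∑ i ∈ S, a i * f (u i) = A T * f T - ∫ s in T0..T, A s * f' s := by
    rw [Finset.sum_congr rfl hpt, Finset.sum_sub_distrib, ← intervalIntegral.integral_finset_sum hind]
    congr 1
    · rw [hAd]; simp only
      rw [Finset.filter_true_of_mem (fun i hi => (hu i hi).2), Finset.sum_mul]
    · congr 1
      ext s
      rw [hAd]; simp only
      rw [Finset.sum_mul, Finset.sum_filter]
      apply Finset.sum_congr rfl
      intro i _
      by_cases h : u i ≤ s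
      · simp [Set.indicator, h]
      · simp [Set.indicator, h]
  have hiA : IntervalIntegrable (fun s => A s * f' s) MeasureTheory.volume T0 T := by
    have : (fun s => A s * f' s) = ∑ i ∈ S, (fun s => a i * (Set.Ici (u i)).indicator f' s) := by
      ext s
      rw [hAd, Finset.sum_apply]; simp only
      rw [Finset.sum_mul, Finset.sum_filter]
      apply Finset.sum_congr rfl
      intro i _
      by_cases h : u i ≤ s
      · simp [Set.indicator, h]
      · simp [Set.indicator, h]
    rw [this]
    exact IntervalIntegrable.sum _ hind
  have e2 : ∑ i ∈ S, a i * f (u i) - (F T - F T0) = f T * (A T - (T - T0)) - ∫ s in T0..T, (A s * f' s - f' s * (s - T0)) := by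
    rw [intervalIntegral.integral_sub hiA hic, hsum]
    linarith
  have e3 : |∫ s in T0..T, (A s * f' s - f' s * (s - T0))| ≤ ∫ s in T0..T, C * g s := by
    rw [← Real.norm_eq_abs]
    apply intervalIntegral.norm_integral_le_of_norm_le hT
    · apply Filter.Eventually.of_forall
      intro s hs
      have hs' : s ∈ Set.Icc T0 T := ⟨hs.1.le, hs.2⟩
      rw [show A s * f' s - f' s * (s - T0) = (A s - (s - T0)) * f' s by ring, Real.norm_eq_abs, abs_mul]
      exact mul_le_mul (hA s hs') (hg s hs') (abs_nonneg _) hC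
    · exact hig.const_mul C
  rw [intervalIntegral.integral_const_mul, eG] at e3
  have e4 : f T * (A T - (T - T0)) ≤ |f T| * C := by
    calc _ ≤ |f T * (A T - (T - T0))| := le_abs_self _
      _ = |f T| * |A T - (T - T0)| := abs_mul _ _
      _ ≤ _ := by
        gcongr
        exact hA T ⟨hT, le_refl _⟩
  have := (abs_le.mp e3).1
  linarith

end St18


namespace St18

open Finset ArithmeticFunction

/-- product of `1 - p` -/
noncomputable def KK (g : ℕ) : ℝ := ∏ p ∈ g.primeFactors, (1 - (p:ℝ))

lemma KK_eq_sum (g : ℕ) (hg : Squarefree g) : KK g = ∑ d ∈ g.divisors, (moebius d : ℝ) * d := by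
  have h := IsMultiplicative.prodPrimeFactors_one_sub_of_squarefree (R := ℝ)
    ((ArithmeticFunction.id : ArithmeticFunction ℕ) : ArithmeticFunction ℝ) 
    (isMultiplicative_id.natCast) hg
  simpa [KK] using h

lemma KK_mul_prime (p g : ℕ) (hp : p.Prime) (hpg : ¬ p ∣ g) : KK (p * g) = (1 - p) * KK g := by
  have hc : Nat.Coprime p g := (Nat.Prime.coprime_iff_not_dvd hp).mpr hpg
  unfold KK
  rw [hc.primeFactors_mul, Finset.prod_union hc.disjoint_primeFactors, hp.primeFactors]
  simp

lemma abs_KK_le (g : ℕ) (hg : 0 < g) : |KK g| ≤ g := by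
  unfold KK
  rw [Finset.abs_prod]
  have h1 : ∏ p ∈ g.primeFactors, |1 - (p:ℝ)| ≤ ∏ p ∈ g.primeFactors, (p:ℝ) := by
    apply Finset.prod_le_prod
    · intros; positivity
    · intro p hp
      have hpp := Nat.prime_of_mem_primeFactors hp
      have : (1:ℝ) ≤ p := by exact_mod_cast hpp.one_le
      rw [abs_le]; constructor <;> linarith
  refine h1.trans ?_
  have := Nat.le_of_dvd hg (Nat.prod_primeFactors_dvd g)
  have h2 : ((∏ p ∈ g.primeFactors, p : ℕ) : ℝ) ≤ g := Nat.cast_le.mpr this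
  push_cast at h2
  exact h2

/-- The sieve majorant's square root. -/
noncomputable def VV (S : Finset ℕ) (y : ℕ → ℝ) (n : ℕ) : ℝ :=
  ∑ r ∈ S, y r / r.totient * KK (Nat.gcd n r)

lemma VV_eq (S : Finset ℕ) (hS : ∀ r ∈ S, Squarefree r) (y : ℕ → ℝ) (n : ℕ) :
    VV S y n = ∑ i ∈ S.sigma (fun r => r.divisors),
      (y i.1 / i.1.totient * (moebius i.2 * i.2)) * (if i.2 ∣ n then 1 else 0) := by
  unfold VV
  rw [Finset.sum_sigma]
  apply Finset.sum_congr rfl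
  intro r hr
  have hr0 : r ≠ 0 := (hS r hr).ne_zero
  rw [KK_eq_sum _ ((hS r hr).squarefree_of_dvd (Nat.gcd_dvd_right n r)), Finset.mul_sum]
  rw [← Finset.sum_subset (s₁ := (Nat.gcd n r).divisors) (s₂ := r.divisors)]
  · apply Finset.sum_congr rfl
    intro d hd
    have : d ∣ n := (Nat.dvd_of_mem_divisors hd).trans (Nat.gcd_dvd_left n r)
    simp [this]
  · exact Nat.divisors_subset_of_dvd hr0 (Nat.gcd_dvd_right n r)
  · intro d hd hd'
    have : ¬ d ∣ n := by
      intro h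
      apply hd'
      simp only [Nat.mem_divisors] at hd ⊢
      exact ⟨Nat.dvd_gcd h hd.1, Nat.gcd_ne_zero_right hr0⟩
    simp [this]

lemma sum_moebius (n : ℕ) : ∑ d ∈ n.divisors, (moebius d : ℝ) = if n = 1 then 1 else 0 := by
  have h := congrArg (fun f : ArithmeticFunction ℤ => f n) coe_zeta_mul_moebius
  simp only [coe_zeta_mul_apply, one_apply] at h
  have := congrArg (fun z : ℤ => (z : ℝ)) h
  push_cast at this
  exact this

lemma MM_eq (f r : ℕ) (hr : Squarefree r) :
    ∑ d ∈ r.divisors, (if f ∣ d then (moebius d : ℝ) else 0) = if f = r then (moebius r : ℝ) else 0 := by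
  have hr0 : r ≠ 0 := hr.ne_zero
  by_cases hf : f ∣ r
  · obtain ⟨k, hk⟩ := hf
    have hf0 : f ≠ 0 := by rintro rfl; simp at hk; exact hr0 hk
    have hk0 : k ≠ 0 := by rintro rfl; simp at hk; exact hr0 hk
    have hc : Nat.Coprime f k := by
      rw [hk] at hr; exact Nat.coprime_of_squarefree_mul hr
    rw [← Finset.sum_filter]
    have : (r.divisors.filter (f ∣ ·)) = k.divisors.image (f * ·) := by
      ext d
      simp only [mem_filter, Nat.mem_divisors, mem_image]
      constructor
      · rintro ⟨⟨h1, _⟩, ⟨e, rfl⟩⟩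
        refine ⟨e, ⟨?_, hk0⟩, rfl⟩
        rw [hk] at h1
        exact Nat.dvd_of_mul_dvd_mul_left (Nat.pos_of_ne_zero hf0) h1
      · rintro ⟨e, ⟨h1, _⟩, rfl⟩
        refine ⟨⟨?_, hr0⟩, dvd_mul_right _ _⟩
        rw [hk]; exact Nat.mul_dvd_mul_left f h1
    rw [this, Finset.sum_image (by
      intro a _ b _ h
      exact Nat.eq_of_mul_eq_mul_left (Nat.pos_of_ne_zero hf0) h)]
    have h2 : ∀ e ∈ k.divisors, (moebius (f * e) : ℝ) = moebius f * moebius e := by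
      intro e he
      have : Nat.Coprime f e := hc.coprime_dvd_right (Nat.dvd_of_mem_divisors he)
      rw [isMultiplicative_moebius.map_mul_of_coprime this]
      push_cast; rfl
    rw [Finset.sum_congr rfl h2, ← Finset.mul_sum, sum_moebius k]
    by_cases h1 : k = 1
    · subst h1; simp at hk; simp [hk]
    · have : f ≠ r := by
        intro h; rw [← h] at hk
        exact h1 (Nat.eq_of_mul_eq_mul_left (Nat.pos_of_ne_zero hf0) (by rw [← hk, mul_one]))
      simp [h1, this]
  · rw [if_neg (by rintro rfl; exact hf dvd_rfl)]
    apply Finset.sum_eq_zero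
    intro d hd
    rw [if_neg]
    intro h; exact hf (h.trans (Nat.dvd_of_mem_divisors hd))

lemma GG_eq (r s : ℕ) (hr : Squarefree r) (hs : Squarefree s) :
    ∑ d ∈ r.divisors, ∑ e ∈ s.divisors, (moebius d : ℝ) * d * (moebius e * e) / (Nat.lcm d e : ℝ)
      = if r = s then (r.totient : ℝ) else 0 := by
  have h1 : ∀ d ∈ r.divisors, ∀ e ∈ s.divisors, (moebius d : ℝ) * d * (moebius e * e) / (Nat.lcm d e : ℝ)
      = ∑ f ∈ r.divisors, (f.totient : ℝ) * ((if f ∣ d then (moebius d : ℝ) else 0) * (if f ∣ e then (moebius e : ℝ) else 0)) := by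
    intro d hd e he
    have hd0 : 0 < d := Nat.pos_of_mem_divisors hd
    have he0 : 0 < e := Nat.pos_of_mem_divisors he
    have hl0 : 0 < Nat.lcm d e := Nat.lcm_pos hd0 he0
    have e1 : (d:ℝ) * e = (Nat.gcd d e : ℝ) * Nat.lcm d e := by exact_mod_cast (Nat.gcd_mul_lcm d e).symm
    have e2 : (Nat.gcd d e : ℝ) = ∑ f ∈ r.divisors, if f ∣ d ∧ f ∣ e then (f.totient : ℝ) else 0 := by
      rw [← Finset.sum_filter]
      have : r.divisors.filter (fun f => f ∣ d ∧ f ∣ e) = (Nat.gcd d e).divisors := by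
        ext f
        simp only [mem_filter, Nat.mem_divisors, Nat.dvd_gcd_iff]
        constructor
        · rintro ⟨_, h⟩; exact ⟨h, Nat.gcd_ne_zero_left hd0.ne'⟩
        · rintro ⟨h, _⟩; exact ⟨⟨h.1.trans (Nat.dvd_of_mem_divisors hd), hr.ne_zero⟩, h⟩
      rw [this]
      exact_mod_cast (Nat.sum_totient (Nat.gcd d e)).symm
    have hl : (Nat.lcm d e : ℝ) ≠ 0 := by exact_mod_cast hl0.ne'
    rw [div_eq_iff hl]
    calc (moebius d : ℝ) * d * (moebius e * e) = moebius d * moebius e * (d * e) := by ring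
      _ = moebius d * moebius e * (Nat.gcd d e : ℝ) * Nat.lcm d e := by rw [e1]; ring
      _ = _ := by
        congr 1
        rw [e2, Finset.mul_sum]
        apply Finset.sum_congr rfl
        intro f _
        by_cases h1 : f ∣ d <;> by_cases h2 : f ∣ e <;> simp [h1, h2]
        ring
  rw [Finset.sum_congr rfl (fun d hd => Finset.sum_congr rfl (h1 d hd))]
  have h2 : ∑ d ∈ r.divisors, ∑ e ∈ s.divisors, ∑ f ∈ r.divisors, (f.totient : ℝ) * ((if f ∣ d then (moebius d : ℝ) else 0) * (if f ∣ e then (moebius e : ℝ) else 0))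
     = ∑ f ∈ r.divisors, (f.totient : ℝ) * ((∑ d ∈ r.divisors, if f ∣ d then (moebius d : ℝ) else 0) * (∑ e ∈ s.divisors, if f ∣ e then (moebius e : ℝ) else 0)) := by
    simp_rw [Finset.sum_mul_sum, Finset.mul_sum]
    rw [Finset.sum_comm (s := r.divisors) (t := r.divisors)]
    refine Finset.sum_congr rfl fun d _ => ?_
    rw [Finset.sum_comm]
  rw [h2]
  simp_rw [MM_eq _ r hr, MM_eq _ s hs]
  rw [Finset.sum_eq_single r]
  · by_cases h : r = s
    · subst h
      simp only [if_true]
      have : (moebius r : ℝ) * moebius r = 1 := by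
        have := moebius_sq_eq_one_of_squarefree hr
        rw [sq] at this
        exact_mod_cast this
      rw [this, mul_one]
    · simp [h]
  · intro f _ hf; simp [hf]
  · intro h; simp [hr.ne_zero] at h

/-- total mass -/
noncomputable def WW (S : Finset ℕ) (y : ℕ → ℝ) : ℝ :=
  ∑ r ∈ S, |y r| / r.totient * ∑ d ∈ r.divisors, (d:ℝ)

lemma mean_value (S : Finset ℕ) (hS : ∀ r ∈ S, Squarefree r) (y : ℕ → ℝ) (X : ℕ) (w : ℕ → ℂ) (ρ E : ℝ)
    (hw : ∀ r ∈ S, ∀ s ∈ S, ∀ d ∈ r.divisors, ∀ e ∈ s.divisors, 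
      ‖∑ n ∈ (Icc 1 X).filter (Nat.lcm d e ∣ ·), w n - ((ρ / (Nat.lcm d e : ℝ) : ℝ) : ℂ)‖ ≤ E) :
    ‖∑ n ∈ Icc 1 X, w n * ((VV S y n ^ 2 : ℝ) : ℂ) - ((ρ * ∑ r ∈ S, y r ^ 2 / r.totient : ℝ) : ℂ)‖ ≤ WW S y ^ 2 * E := by
  set I := S.sigma (fun r => r.divisors) with hI
  set a : (Σ _ : ℕ, ℕ) → ℝ := fun i => y i.1 / i.1.totient * (moebius i.2 * i.2) with ha
  have e1 : ∑ n ∈ Icc 1 X, w n * ((VV S y n ^ 2 : ℝ) : ℂ) = 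
      ∑ i ∈ I, ∑ j ∈ I, ((a i * a j : ℝ) : ℂ) * ∑ n ∈ (Icc 1 X).filter (Nat.lcm i.2 j.2 ∣ ·), w n := by
    have : ∀ n ∈ Icc 1 X, w n * ((VV S y n ^ 2 : ℝ) : ℂ) = ∑ i ∈ I, ∑ j ∈ I, ((a i * a j : ℝ) : ℂ) * (if Nat.lcm i.2 j.2 ∣ n then w n else 0) := by
      intro n _
      rw [VV_eq S hS y n, sq, Finset.sum_mul_sum]
      push_cast
      rw [Finset.mul_sum]
      refine Finset.sum_congr rfl fun i _ => ?_
      rw [Finset.mul_sum]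
      refine Finset.sum_congr rfl fun j _ => ?_
      rw [ha]
      by_cases h1 : i.2 ∣ n <;> by_cases h2 : j.2 ∣ n <;> simp [h1, h2, Nat.lcm_dvd_iff]
      ring
    rw [Finset.sum_congr rfl this, Finset.sum_comm]
    refine Finset.sum_congr rfl fun i _ => ?_
    rw [Finset.sum_comm]
    refine Finset.sum_congr rfl fun j _ => ?_
    rw [← Finset.mul_sum, Finset.sum_filter]
  have e2 : ∑ i ∈ I, ∑ j ∈ I, a i * a j * (ρ / (Nat.lcm i.2 j.2 : ℝ)) = ρ * ∑ r ∈ S, y r ^ 2 / r.totient := by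
    have : ∑ i ∈ I, ∑ j ∈ I, a i * a j * (ρ / (Nat.lcm i.2 j.2 : ℝ)) = 
       ∑ r ∈ S, ∑ s ∈ S, ρ * (y r / r.totient) * (y s / s.totient) * ∑ d ∈ r.divisors, ∑ e ∈ s.divisors, (moebius d : ℝ) * d * (moebius e * e) / (Nat.lcm d e : ℝ) := by
      rw [hI]
      rw [Finset.sum_sigma]
      refine Finset.sum_congr rfl fun r _ => ?_
      simp_rw [Finset.sum_sigma, Finset.mul_sum]
      rw [Finset.sum_comm]
      refine Finset.sum_congr rfl fun s _ => ?_
      refine Finset.sum_congr rfl fun d _ => ?_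
      refine Finset.sum_congr rfl fun e _ => ?_
      rw [ha]; simp only; ring
    rw [this, Finset.mul_sum]
    refine Finset.sum_congr rfl fun r hr => ?_
    rw [Finset.sum_eq_single r]
    · rw [GG_eq r r (hS r hr) (hS r hr), if_pos rfl]
      have : (r.totient : ℝ) ≠ 0 := by
        have := Nat.totient_pos.mpr (Nat.pos_of_ne_zero (hS r hr).ne_zero)
        exact_mod_cast this.ne'
      field_simp
    · intro s hs hne
      rw [GG_eq r s (hS r hr) (hS s hs), if_neg hne.symm, mul_zero]
    · intro h; exact absurd hr h
  have e3 : ∑ n ∈ Icc 1 X, w n * ((VV S y n ^ 2 : ℝ) : ℂ) - ((ρ * ∑ r ∈ S, y r ^ 2 / r.totient : ℝ) : ℂ) =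
      ∑ i ∈ I, ∑ j ∈ I, ((a i * a j : ℝ) : ℂ) * (∑ n ∈ (Icc 1 X).filter (Nat.lcm i.2 j.2 ∣ ·), w n - ((ρ / (Nat.lcm i.2 j.2 : ℝ) : ℝ) : ℂ)) := by
    rw [e1, ← e2]
    push_cast
    simp_rw [mul_sub, Finset.sum_sub_distrib]
  have e4 : ∑ i ∈ I, |a i| ≤ WW S y := by
    unfold WW
    rw [hI, Finset.sum_sigma]
    refine Finset.sum_le_sum fun r _ => ?_
    rw [Finset.mul_sum]
    refine Finset.sum_le_sum fun d _ => ?_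
    rw [ha]; simp only
    rw [abs_mul, abs_mul, abs_div, Nat.abs_cast, Nat.abs_cast]
    have : |(moebius d : ℝ)| ≤ 1 := by exact_mod_cast abs_moebius_le_one (n := d)
    have h2 : 0 ≤ |y r| / r.totient := by positivity
    calc |y r| / r.totient * (|(moebius d : ℝ)| * d) ≤ |y r| / r.totient * (1 * d) := by gcongr
      _ = _ := by ring
  rw [e3]
  have hE : ∀ i ∈ I, ∀ j ∈ I, ‖∑ n ∈ (Icc 1 X).filter (Nat.lcm i.2 j.2 ∣ ·), w n - ((ρ / (Nat.lcm i.2 j.2 : ℝ) : ℝ) : ℂ)‖ ≤ E := by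
    intro i hi j hj
    rw [hI, Finset.mem_sigma] at hi hj
    exact hw i.1 hi.1 j.1 hj.1 i.2 hi.2 j.2 hj.2
  calc _ ≤ ∑ i ∈ I, ∑ j ∈ I, |a i| * |a j| * E := by
        refine (norm_sum_le _ _).trans (Finset.sum_le_sum fun i hi => ?_)
        refine (norm_sum_le _ _).trans (Finset.sum_le_sum fun j hj => ?_)
        rw [norm_mul, Complex.norm_real, Real.norm_eq_abs, abs_mul]
        gcongr
        exact hE i hi j hj
    _ = (∑ i ∈ I, |a i|) ^ 2 * E := by
        rw [sq, Finset.sum_mul_sum, Finset.sum_mul]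
        refine Finset.sum_congr rfl fun i _ => ?_
        rw [Finset.sum_mul]
    _ ≤ _ := by
        rcases Finset.eq_empty_or_nonempty I with h | ⟨i, hi⟩
        · have h0 : 0 ≤ WW S y := by
            unfold WW; positivity
          have : S = ∅ := by
            by_contra hne
            obtain ⟨r, hr⟩ := Finset.nonempty_iff_ne_empty.mpr hne
            have : (⟨r, 1⟩ : Σ _ : ℕ, ℕ) ∈ I := by
              rw [hI, Finset.mem_sigma]; exact ⟨hr, by simp [(hS r hr).ne_zero]⟩
            rw [h] at this; simp at this
          subst this
          rw [h]; simp [WW]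
        · have : 0 ≤ E := (norm_nonneg _).trans (hE i hi i hi)
          have h0 : 0 ≤ ∑ i ∈ I, |a i| := by positivity
          gcongr

end St18


namespace St18

open Finset ArithmeticFunction

lemma sum_filter_dvd {M : Type*} [AddCommMonoid M] (X l : ℕ) (hl : 0 < l) (g : ℕ → M) :
    ∑ n ∈ (Icc 1 X).filter (l ∣ ·), g n = ∑ k ∈ Icc 1 (X / l), g (l * k) := by
  symm
  apply Finset.sum_bij' (fun k _ => l * k) (fun n _ => n / l)
  · intro k hk
    simp only [mem_filter, mem_Icc] at hk ⊢
    refine ⟨⟨Nat.mul_pos hl hk.1, ?_⟩, dvd_mul_right _ _⟩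
    rw [mul_comm]; exact (Nat.le_div_iff_mul_le hl).mp hk.2
  · intro n hn
    simp only [mem_filter, mem_Icc] at hn ⊢
    exact ⟨Nat.div_pos (Nat.le_of_dvd hn.1.1 hn.2) hl, Nat.div_le_div_right hn.1.2⟩
  · intro k _; exact Nat.mul_div_cancel_left k hl
  · intro n hn
    simp only [mem_filter, mem_Icc] at hn
    exact Nat.mul_div_cancel' hn.2
  · intro k _; rfl

lemma card_dvd (X l : ℕ) (hl : 0 < l) : #((Icc 1 X).filter (l ∣ ·)) = X / l := by
  have := sum_filter_dvd X l hl (fun _ => 1)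
  simpa using this

lemma sum_moebius_div (m : ℕ) (hm : 0 < m) :
    ∑ d ∈ m.divisors, (moebius d : ℝ) / d = m.totient / m := by
  have h := (sum_eq_iff_sum_mul_moebius_eq (R := ℝ) (f := fun n => (n.totient : ℝ)) (g := fun n => (n : ℝ))).mp
    (fun n _ => by exact_mod_cast Nat.sum_totient n) m hm
  have hm' : (m:ℝ) ≠ 0 := by exact_mod_cast hm.ne'
  rw [← h, Nat.sum_divisorsAntidiagonal (f := fun a b => (moebius a : ℝ) * (b : ℝ)), Finset.sum_div]
  apply Finset.sum_congr rfl
  intro d hd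
  have hd0 : (d:ℝ) ≠ 0 := by exact_mod_cast (Nat.pos_of_mem_divisors hd).ne'
  rw [Nat.cast_div (Nat.dvd_of_mem_divisors hd) hd0]
  field_simp

lemma coprime_count (m l X : ℕ) (hm : 0 < m) (hl : 0 < l) (hlm : Nat.Coprime l m) :
    |∑ n ∈ (Icc 1 X).filter (l ∣ ·), (if Nat.Coprime n m then (1:ℝ) else 0) - (m.totient / m * X) / l| ≤ m.divisors.card := by
  have e1 : ∑ n ∈ (Icc 1 X).filter (l ∣ ·), (if Nat.Coprime n m then (1:ℝ) else 0) 
      = ∑ d ∈ m.divisors, (moebius d : ℝ) * ((X / (l * d) : ℕ) : ℝ) := by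
    have : ∀ n ∈ (Icc 1 X).filter (l ∣ ·), (if Nat.Coprime n m then (1:ℝ) else 0) = 
        ∑ d ∈ m.divisors, if d ∣ n then (moebius d : ℝ) else 0 := by
      intro n hn
      have h := sum_moebius (Nat.gcd n m)
      rw [← Finset.sum_filter]
      have e : m.divisors.filter (· ∣ n) = (Nat.gcd n m).divisors := by
        ext d
        simp only [mem_filter, Nat.mem_divisors, Nat.dvd_gcd_iff]
        constructor
        · rintro ⟨⟨h1, _⟩, h2⟩; exact ⟨⟨h2, h1⟩, Nat.gcd_ne_zero_right hm.ne'⟩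
        · rintro ⟨⟨h1, h2⟩, _⟩; exact ⟨⟨h2, hm.ne'⟩, h1⟩
      rw [e, h]
    rw [Finset.sum_congr rfl this, Finset.sum_comm]
    apply Finset.sum_congr rfl
    intro d hd
    have hd0 := Nat.pos_of_mem_divisors hd
    have hc : Nat.Coprime l d := hlm.coprime_dvd_right (Nat.dvd_of_mem_divisors hd)
    rw [← Finset.sum_filter, Finset.filter_filter]
    have : (Icc 1 X).filter (fun a => l ∣ a ∧ d ∣ a) = (Icc 1 X).filter (l * d ∣ ·) := by
      apply Finset.filter_congr
      intro n _
      exact ⟨fun h => hc.mul_dvd_of_dvd_of_dvd h.1 h.2, fun h => ⟨(dvd_mul_right l d).trans h, (dvd_mul_left d l).trans h⟩⟩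
    rw [this]
    simp [card_dvd X (l * d) (Nat.mul_pos hl hd0)]
    ring
  have hl' : (l:ℝ) ≠ 0 := by exact_mod_cast hl.ne'
  have e2 : (m.totient / m * X : ℝ) / l = ∑ d ∈ m.divisors, (moebius d : ℝ) * ((X:ℝ) / (l * d)) := by
    rw [← sum_moebius_div m hm, Finset.sum_mul, Finset.sum_div]
    apply Finset.sum_congr rfl
    intro d hd
    have hd0 : (d:ℝ) ≠ 0 := by exact_mod_cast (Nat.pos_of_mem_divisors hd).ne'
    field_simp
  rw [e1, e2, ← Finset.sum_sub_distrib]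
  calc _ ≤ ∑ d ∈ m.divisors, |(moebius d : ℝ) * ((X / (l * d) : ℕ) : ℝ) - (moebius d : ℝ) * ((X:ℝ) / (l * d))| := Finset.abs_sum_le_sum_abs _ _
    _ ≤ ∑ d ∈ m.divisors, (1:ℝ) := by
      apply Finset.sum_le_sum
      intro d hd
      have hd0 := Nat.pos_of_mem_divisors hd
      rw [← mul_sub, abs_mul]
      have h1 : |(moebius d : ℝ)| ≤ 1 := by exact_mod_cast abs_moebius_le_one (n := d)
      have h2 : |((X / (l * d) : ℕ) : ℝ) - (X:ℝ) / (l * d)| ≤ 1 := by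
        have h3 := Nat.lt_floor_add_one ((X:ℝ) / ((l * d : ℕ) : ℝ))
        have h4 := Nat.floor_le (a := (X:ℝ) / ((l * d : ℕ) : ℝ)) (by positivity)
        rw [Nat.floor_div_natCast, Nat.floor_natCast] at h3 h4
        rw [abs_le]; push_cast at h3 h4 ⊢
        constructor <;> linarith
      exact mul_le_one₀ h1 (abs_nonneg _) h2
    _ = _ := by simp

/-- sieving support -/
def SS (Z m : ℕ) : Finset ℕ := (Icc 1 Z).filter (fun r => Squarefree r ∧ Nat.Coprime r m)

lemma mem_SS {Z m r : ℕ} : r ∈ SS Z m ↔ (1 ≤ r ∧ r ≤ Z) ∧ Squarefree r ∧ Nat.Coprime r m := by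
  simp [SS]

/-- shifted weight -/
noncomputable def sh (p : ℕ) (y : ℕ → ℝ) (r : ℕ) : ℝ := if p ∣ r then 0 else y r - y (p * r)

lemma VV_shift (Z m p n : ℕ) (y : ℕ → ℝ) (hy : ∀ r, Z < r → y r = 0) (hp : p.Prime) (hpm : Nat.Coprime p m) (hn : p ∣ n) :
    VV (SS Z m) y n = VV (SS Z m) (sh p y) n := by
  unfold VV
  have h0 : ∑ r ∈ SS Z m, y r / r.totient * KK (Nat.gcd n r) =
      ∑ r ∈ (SS Z m).filter (fun r => ¬ p ∣ r), y r / r.totient * KK (Nat.gcd n r) + ∑ r ∈ (SS Z m).filter (p ∣ ·), y r / r.totient * KK (Nat.gcd n r) := by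
    rw [add_comm]; exact (Finset.sum_filter_add_sum_filter_not _ _ _).symm
  have h1 : ∑ r ∈ (SS Z m).filter (p ∣ ·), y r / r.totient * KK (Nat.gcd n r) =
      ∑ r ∈ (SS Z m).filter (fun r => ¬ p ∣ r), - (y (p * r) / r.totient * KK (Nat.gcd n r)) := by
    have h2 : ∑ r ∈ (SS Z m).filter (fun r => ¬ p ∣ r), - (y (p * r) / r.totient * KK (Nat.gcd n r)) =
        ∑ r ∈ ((SS Z m).filter (fun r => ¬ p ∣ r)).filter (fun r => p * r ≤ Z), - (y (p * r) / r.totient * KK (Nat.gcd n r)) := by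
      symm
      apply Finset.sum_subset (Finset.filter_subset _ _)
      intro r hr hr'
      have : Z < p * r := by
        by_contra h
        exact hr' (Finset.mem_filter.mpr ⟨hr, not_lt.mp h⟩)
      rw [hy _ this]; simp
    rw [h2]
    symm
    apply Finset.sum_bij' (fun r _ => p * r) (fun r _ => r / p)
    · intro r hr
      simp only [mem_filter, mem_SS] at hr ⊢
      obtain ⟨⟨⟨⟨h1, h2⟩, h3, h4⟩, h5⟩, h6⟩ := hr
      have hc : Nat.Coprime p r := (Nat.Prime.coprime_iff_not_dvd hp).mpr h5
      refine ⟨⟨⟨Nat.mul_pos hp.pos h1, h6⟩, ?_, ?_⟩, dvd_mul_right _ _⟩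
      · exact (Nat.squarefree_mul hc).mpr ⟨hp.squarefree, h3⟩
      · exact Nat.Coprime.mul_left hpm h4
    · intro r hr
      simp only [mem_filter, mem_SS] at hr ⊢
      obtain ⟨⟨⟨h1, h2⟩, h3, h4⟩, ⟨k, rfl⟩⟩ := hr
      rw [Nat.mul_div_cancel_left _ hp.pos]
      have hc := Nat.coprime_of_squarefree_mul h3
      refine ⟨⟨⟨⟨?_, ?_⟩, ?_, ?_⟩, ?_⟩, h2⟩
      · exact Nat.pos_of_mul_pos_left h1
      · exact (Nat.le_mul_of_pos_left k hp.pos).trans h2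
      · exact h3.squarefree_of_dvd (dvd_mul_left _ _)
      · exact h4.coprime_dvd_left (dvd_mul_left _ _)
      · exact (Nat.Prime.coprime_iff_not_dvd hp).mp hc
    · intro r _; exact Nat.mul_div_cancel_left _ hp.pos
    · intro r hr
      simp only [mem_filter] at hr
      exact Nat.mul_div_cancel' hr.2
    · intro r hr
      simp only [mem_filter, mem_SS] at hr
      obtain ⟨⟨⟨⟨h1, h2⟩, h3, h4⟩, h5⟩, h6⟩ := hr
      have hc : Nat.Coprime p r := (Nat.Prime.coprime_iff_not_dvd hp).mpr h5
      have hg : Nat.gcd n (p * r) = p * Nat.gcd n r := by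
        rw [Nat.Coprime.gcd_mul n hc, Nat.gcd_eq_right hn]
      have hpg : ¬ p ∣ Nat.gcd n r := fun h => h5 (h.trans (Nat.gcd_dvd_right _ _))
      rw [hg, KK_mul_prime p _ hp hpg, Nat.totient_mul hc, Nat.totient_prime hp]
      have ht : (r.totient : ℝ) ≠ 0 := by
        exact_mod_cast (Nat.totient_pos.mpr h1).ne'
      have hp2 : (2:ℝ) ≤ p := by exact_mod_cast hp.two_le
      have hp1 : (p:ℝ) - 1 ≠ 0 := by linarith
      push_cast [Nat.cast_sub hp.one_le]
      field_simp
      ring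
  rw [h0, h1, ← Finset.sum_add_distrib, Finset.sum_filter]
  apply Finset.sum_congr rfl
  intro r _
  unfold sh
  by_cases h : p ∣ r
  · simp [h]
  · simp [h]; ring

lemma VV_shift_mul (Z m p k n : ℕ) (y : ℕ → ℝ) (hp : p.Prime) :
    VV (SS Z m) (sh p y) (p ^ k * n) = VV (SS Z m) (sh p y) n := by
  unfold VV
  apply Finset.sum_congr rfl
  intro r _
  by_cases h : p ∣ r
  · simp [sh, h]
  · have hc : Nat.Coprime (p ^ k) r := Nat.Coprime.pow_left _ ((Nat.Prime.coprime_iff_not_dvd hp).mpr h)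
    rw [Nat.Coprime.gcd_mul_left_cancel n hc]

lemma sum_pk (Z m p k X : ℕ) (y : ℕ → ℝ) (hy : ∀ r, Z < r → y r = 0) (hp : p.Prime) (hpm : Nat.Coprime p m) (hk : k ≠ 0) (w : ℕ → ℂ) :
    ∑ n ∈ (Icc 1 X).filter (p ^ k ∣ ·), w n * ((VV (SS Z m) y n ^ 2 : ℝ) : ℂ) =
     ∑ n ∈ Icc 1 (X / p ^ k), w (p ^ k * n) * ((VV (SS Z m) (sh p y) n ^ 2 : ℝ) : ℂ) := by
  rw [sum_filter_dvd _ _ (pow_pos hp.pos k)]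
  apply Finset.sum_congr rfl
  intro n _
  rw [VV_shift Z m p _ y hy hp hpm ((dvd_pow_self p hk).trans (dvd_mul_right _ _)), VV_shift_mul Z m p k n y hp]

lemma mean_cop (Z m X : ℕ) (hm : 0 < m) (y : ℕ → ℝ) :
    |∑ n ∈ Icc 1 X, (if Nat.Coprime n m then (1:ℝ) else 0) * VV (SS Z m) y n ^ 2 - (m.totient / m * X) * ∑ r ∈ SS Z m, y r ^ 2 / r.totient|
      ≤ WW (SS Z m) y ^ 2 * m.divisors.card := by
  have h := mean_value (SS Z m) (fun r hr => (mem_SS.mp hr).2.1) y X (fun n => (((if Nat.Coprime n m then (1:ℝ) else 0) : ℝ) : ℂ))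
    (m.totient / m * X) m.divisors.card ?_
  · rw [← Real.norm_eq_abs, ← Complex.norm_real]
    push_cast at h ⊢
    exact h
  · intro r hr s hs d hd e he
    have hd0 := Nat.pos_of_mem_divisors hd
    have he0 := Nat.pos_of_mem_divisors he
    have hrm := ((mem_SS.mp hr).2.2).coprime_dvd_left (Nat.dvd_of_mem_divisors hd)
    have hsm := ((mem_SS.mp hs).2.2).coprime_dvd_left (Nat.dvd_of_mem_divisors he)
    have hl : Nat.Coprime (Nat.lcm d e) m := 
      (Nat.Coprime.mul_left hrm hsm).coprime_dvd_left (Nat.lcm_dvd_mul d e)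
    have := coprime_count m (Nat.lcm d e) X hm (Nat.lcm_pos hd0 he0) hl
    rw [← Real.norm_eq_abs, ← Complex.norm_real] at this
    push_cast at this ⊢
    exact this

lemma mean_char (Z m X : ℕ) [NeZero m] (y : ℕ → ℝ) (χ : DirichletCharacter ℂ m) (B : ℝ)
    (hB : ∀ N : ℕ, ‖∑ n ∈ Icc 1 N, χ (n : ZMod m)‖ ≤ B) :
    ‖∑ n ∈ Icc 1 X, χ (n : ZMod m) * ((VV (SS Z m) y n ^ 2 : ℝ) : ℂ)‖ ≤ WW (SS Z m) y ^ 2 * B := by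
  have h := mean_value (SS Z m) (fun r hr => (mem_SS.mp hr).2.1) y X (fun n => χ (n : ZMod m)) 0 B ?_
  · simpa using h
  · intro r hr s hs d hd e he
    have hd0 := Nat.pos_of_mem_divisors hd
    have he0 := Nat.pos_of_mem_divisors he
    rw [sum_filter_dvd _ _ (Nat.lcm_pos hd0 he0)]
    simp only [zero_div, Complex.ofReal_zero, sub_zero, Nat.cast_mul, map_mul]
    rw [← Finset.mul_sum, norm_mul]
    calc _ ≤ 1 * ‖∑ n ∈ Icc 1 (X / Nat.lcm d e), χ (n : ZMod m)‖ := by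
          gcongr; exact χ.norm_le_one _
      _ ≤ _ := by rw [one_mul]; exact hB _

/-- The lower-bound weight. -/
noncomputable def RR (Z m : ℕ) (y : ℕ → ℝ) (P : Finset ℕ) (wt : ℕ → ℝ) (n : ℕ) : ℝ :=
  VV (SS Z m) y n ^ 2 * (1 - ∑ p ∈ P, (wt p * (if p ^ 1 ∣ n then 1 else 0) + (if p ^ 2 ∣ n then 1 else 0)))

lemma sum_RR (Z m X : ℕ) (y : ℕ → ℝ) (hy : ∀ r, Z < r → y r = 0) (P : Finset ℕ) (wt : ℕ → ℝ)
    (hP : ∀ p ∈ P, p.Prime ∧ Nat.Coprime p m) (w : ℕ → ℂ) :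
    ∑ n ∈ Icc 1 X, w n * ((RR Z m y P wt n : ℝ) : ℂ) = ∑ n ∈ Icc 1 X, w n * ((VV (SS Z m) y n ^ 2 : ℝ) : ℂ) -
      ∑ p ∈ P, ((wt p : ℂ) * ∑ n ∈ Icc 1 (X / p ^ 1), w (p ^ 1 * n) * ((VV (SS Z m) (sh p y) n ^ 2 : ℝ) : ℂ) 
        + ∑ n ∈ Icc 1 (X / p ^ 2), w (p ^ 2 * n) * ((VV (SS Z m) (sh p y) n ^ 2 : ℝ) : ℂ)) := by
  have : ∀ p ∈ P, ((wt p : ℂ) * ∑ n ∈ Icc 1 (X / p ^ 1), w (p ^ 1 * n) * ((VV (SS Z m) (sh p y) n ^ 2 : ℝ) : ℂ) 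
        + ∑ n ∈ Icc 1 (X / p ^ 2), w (p ^ 2 * n) * ((VV (SS Z m) (sh p y) n ^ 2 : ℝ) : ℂ)) = 
        ∑ n ∈ Icc 1 X, w n * ((VV (SS Z m) y n ^ 2 : ℝ) : ℂ) * (wt p * (if p ^ 1 ∣ n then 1 else 0) + (if p ^ 2 ∣ n then 1 else 0)) := by
    intro p hp
    rw [← sum_pk Z m p 1 X y hy (hP p hp).1 (hP p hp).2 (by norm_num) w, ← sum_pk Z m p 2 X y hy (hP p hp).1 (hP p hp).2 (by norm_num) w]
    rw [Finset.mul_sum, Finset.sum_filter, Finset.sum_filter, ← Finset.sum_add_distrib]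
    apply Finset.sum_congr rfl
    intro n _
    split_ifs <;> ring
  rw [Finset.sum_congr rfl this, Finset.sum_comm, ← Finset.sum_sub_distrib]
  apply Finset.sum_congr rfl
  intro n _
  rw [← Finset.mul_sum, RR]
  push_cast
  have : ∑ p ∈ P, ((wt p : ℂ) * ((if p ^ 1 ∣ n then (1:ℝ) else 0 : ℝ) : ℂ) + ((if p ^ 2 ∣ n then (1:ℝ) else 0 : ℝ) : ℂ)) =
     ∑ p ∈ P, ((wt p : ℂ) * (if p ^ 1 ∣ n then 1 else 0) + (if p ^ 2 ∣ n then 1 else 0)) := by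
    apply Finset.sum_congr rfl
    intro p _
    split_ifs <;> simp
  rw [this]
  ring

lemma RR_char (Z m X Y : ℕ) [NeZero m] (y : ℕ → ℝ) (hy : ∀ r, Z < r → y r = 0) (P : Finset ℕ) (wt : ℕ → ℝ)
    (hP : ∀ p ∈ P, p.Prime ∧ Nat.Coprime p m) (hPY : P ⊆ Icc 1 Y) (hwt : ∀ p ∈ P, 0 ≤ wt p ∧ wt p ≤ 1) (W : ℝ)
    (hW0 : WW (SS Z m) y ^ 2 ≤ W) (hW : ∀ p ∈ P, WW (SS Z m) (sh p y) ^ 2 ≤ W)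
    (χ : DirichletCharacter ℂ m) (B : ℝ)
    (hB : ∀ N : ℕ, ‖∑ n ∈ Icc 1 N, χ (n : ZMod m)‖ ≤ B) :
    ‖∑ n ∈ Icc 1 X, χ (n : ZMod m) * ((RR Z m y P wt n : ℝ) : ℂ)‖ ≤ (1 + 2 * Y) * (W * B) := by
  have hB0 : 0 ≤ B := (norm_nonneg _).trans (hB 0)
  have hWW : 0 ≤ W := (sq_nonneg _).trans hW0
  rw [sum_RR Z m X y hy P wt hP]
  have h1 : ‖∑ n ∈ Icc 1 X, χ (n : ZMod m) * ((VV (SS Z m) y n ^ 2 : ℝ) : ℂ)‖ ≤ W * B :=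
    (mean_char Z m X y χ B hB).trans (by gcongr)
  have h2 : ∀ p ∈ P, ∀ k : ℕ, ‖∑ n ∈ Icc 1 (X / p ^ k), χ ((p ^ k * n : ℕ) : ZMod m) * ((VV (SS Z m) (sh p y) n ^ 2 : ℝ) : ℂ)‖ ≤ W * B := by
    intro p hp k
    simp only [Nat.cast_mul, map_mul, mul_assoc]
    rw [← Finset.mul_sum, norm_mul]
    calc _ ≤ 1 * (WW (SS Z m) (sh p y) ^ 2 * B) := by
          gcongr
          · exact χ.norm_le_one _
          · exact mean_char Z m _ _ χ B hB
      _ ≤ _ := by rw [one_mul]; gcongr; exact hW p hp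
  calc _ ≤ W * B + ∑ p ∈ P, (2 * (W * B)) := by
        refine (norm_sub_le _ _).trans (add_le_add h1 ?_)
        refine (norm_sum_le _ _).trans (Finset.sum_le_sum fun p hp => ?_)
        refine (norm_add_le _ _).trans ?_
        have a1 := h2 p hp 1
        have a2 := h2 p hp 2
        have a3 : ‖(wt p : ℂ) * ∑ n ∈ Icc 1 (X / p ^ 1), χ ((p ^ 1 * n : ℕ) : ZMod m) * ((VV (SS Z m) (sh p y) n ^ 2 : ℝ) : ℂ)‖ ≤ 1 * (W * B) := by
          rw [norm_mul, Complex.norm_real, Real.norm_of_nonneg (hwt p hp).1]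
          gcongr
          exact (hwt p hp).2
        linarith
    _ = W * B + #P * (2 * (W * B)) := by simp
    _ ≤ W * B + Y * (2 * (W * B)) := by
        gcongr
        calc #P ≤ #(Icc 1 Y) := Finset.card_le_card hPY
          _ = Y := by simp
    _ = _ := by ring

lemma RR_cop (Z m X Y : ℕ) [NeZero m] (y : ℕ → ℝ) (hy : ∀ r, Z < r → y r = 0) (P : Finset ℕ) (wt : ℕ → ℝ)
    (hP : ∀ p ∈ P, p.Prime ∧ Nat.Coprime p m) (hPY : P ⊆ Icc 1 Y) (hwt : ∀ p ∈ P, 0 ≤ wt p ∧ wt p ≤ 1) (W : ℝ)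
    (hW0 : WW (SS Z m) y ^ 2 ≤ W) (hW : ∀ p ∈ P, WW (SS Z m) (sh p y) ^ 2 ≤ W) :
    (m.totient / m * X : ℝ) * (∑ r ∈ SS Z m, y r ^ 2 / r.totient - ∑ p ∈ P, (wt p / p + 1 / (p:ℝ)^2) * ∑ r ∈ SS Z m, sh p y r ^ 2 / r.totient)
      - (1 + 2 * Y) * (W * m.divisors.card) ≤ ∑ n ∈ Icc 1 X, (if Nat.Coprime n m then (1:ℝ) else 0) * RR Z m y P wt n := by
  have hm : 0 < m := Nat.pos_of_ne_zero (NeZero.ne m)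
  have hWW : 0 ≤ W := (sq_nonneg _).trans hW0
  set τ : ℝ := (m.divisors.card : ℝ)
  have hτ : 0 ≤ τ := by positivity
  set ι : ℕ → ℝ := fun n => if Nat.Coprime n m then (1:ℝ) else 0 with hι
  have e : ∑ n ∈ Icc 1 X, ι n * RR Z m y P wt n = ∑ n ∈ Icc 1 X, ι n * VV (SS Z m) y n ^ 2 -
      ∑ p ∈ P, (wt p * ∑ n ∈ Icc 1 (X / p ^ 1), ι (p ^ 1 * n) * VV (SS Z m) (sh p y) n ^ 2
        + ∑ n ∈ Icc 1 (X / p ^ 2), ι (p ^ 2 * n) * VV (SS Z m) (sh p y) n ^ 2) := by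
    have := sum_RR Z m X y hy P wt hP (fun n => ((ι n : ℝ) : ℂ))
    exact_mod_cast this
  rw [e]
  have h1 : -(WW (SS Z m) y ^ 2 * τ) ≤ ∑ n ∈ Icc 1 X, ι n * VV (SS Z m) y n ^ 2 - (m.totient / m * X : ℝ) * ∑ r ∈ SS Z m, y r ^ 2 / r.totient :=
    (abs_le.mp (mean_cop Z m X hm y)).1
  have h2 : ∀ p ∈ P, ∀ k : ℕ, ∑ n ∈ Icc 1 (X / p ^ k), ι (p ^ k * n) * VV (SS Z m) (sh p y) n ^ 2 ≤
      (m.totient / m * X : ℝ) * (1 / (p:ℝ) ^ k * ∑ r ∈ SS Z m, sh p y r ^ 2 / r.totient) + W * τ := by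
    intro p hp k
    have hc : Nat.Coprime (p ^ k) m := Nat.Coprime.pow_left _ (hP p hp).2
    have : ∀ n, ι (p ^ k * n) = ι n := by
      intro n
      have hiff : Nat.Coprime (p ^ k * n) m ↔ Nat.Coprime n m := by
        rw [Nat.coprime_mul_iff_left]; exact ⟨fun h => h.2, fun h => ⟨hc, h⟩⟩
      exact if_congr hiff rfl rfl
    simp_rw [this]
    have h3 : ∑ n ∈ Icc 1 (X / p ^ k), ι n * VV (SS Z m) (sh p y) n ^ 2 - (m.totient / m * ((X / p ^ k : ℕ) : ℝ)) * ∑ r ∈ SS Z m, sh p y r ^ 2 / r.totient ≤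
       WW (SS Z m) (sh p y) ^ 2 * τ := (abs_le.mp (mean_cop Z m (X / p ^ k) hm (sh p y))).2
    have hQ : 0 ≤ ∑ r ∈ SS Z m, sh p y r ^ 2 / r.totient := by positivity
    have h4 : ((X / p ^ k : ℕ) : ℝ) ≤ X * (1 / (p:ℝ) ^ k) := by
      rw [mul_one_div]; exact_mod_cast Nat.cast_div_le (α := ℝ) (m := X) (n := p ^ k)
    have h5 := hW p hp
    have h6 : (m.totient / m * ((X / p ^ k : ℕ) : ℝ)) * ∑ r ∈ SS Z m, sh p y r ^ 2 / r.totient ≤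
       (m.totient / m * (X * (1 / (p:ℝ) ^ k))) * ∑ r ∈ SS Z m, sh p y r ^ 2 / r.totient := by gcongr
    have h7 : WW (SS Z m) (sh p y) ^ 2 * τ ≤ W * τ := by gcongr
    have e9 : (m.totient / m * X : ℝ) * (1 / (p:ℝ) ^ k * ∑ r ∈ SS Z m, sh p y r ^ 2 / r.totient) =
       (m.totient / m * (X * (1 / (p:ℝ) ^ k))) * ∑ r ∈ SS Z m, sh p y r ^ 2 / r.totient := by ring
    rw [e9]
    linarith
  have h8 : ∑ p ∈ P, (wt p * ∑ n ∈ Icc 1 (X / p ^ 1), ι (p ^ 1 * n) * VV (SS Z m) (sh p y) n ^ 2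
        + ∑ n ∈ Icc 1 (X / p ^ 2), ι (p ^ 2 * n) * VV (SS Z m) (sh p y) n ^ 2) ≤ 
      ∑ p ∈ P, ((m.totient / m * X : ℝ) * ((wt p / p + 1 / (p:ℝ)^2) * ∑ r ∈ SS Z m, sh p y r ^ 2 / r.totient) + 2 * (W * τ)) := by
    apply Finset.sum_le_sum
    intro p hp
    have a1 := h2 p hp 1
    have a2 := h2 p hp 2
    have a3 := mul_le_mul_of_nonneg_left a1 (hwt p hp).1
    have a4 : wt p * (W * τ) ≤ 1 * (W * τ) := by
      gcongr; exact (hwt p hp).2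
    have e5 : (m.totient / m * X : ℝ) * ((wt p / p + 1 / (p:ℝ)^2) * ∑ r ∈ SS Z m, sh p y r ^ 2 / r.totient) =
      wt p * ((m.totient / m * X : ℝ) * (1 / (p:ℝ) ^ 1 * ∑ r ∈ SS Z m, sh p y r ^ 2 / r.totient)) + 
      (m.totient / m * X : ℝ) * (1 / (p:ℝ) ^ 2 * ∑ r ∈ SS Z m, sh p y r ^ 2 / r.totient) := by ring
    rw [e5]
    linarith
  have e8 : ∑ p ∈ P, ((m.totient / m * X : ℝ) * ((wt p / p + 1 / (p:ℝ)^2) * ∑ r ∈ SS Z m, sh p y r ^ 2 / r.totient) + 2 * (W * τ)) =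
      (m.totient / m * X : ℝ) * ∑ p ∈ P, ((wt p / p + 1 / (p:ℝ)^2) * ∑ r ∈ SS Z m, sh p y r ^ 2 / r.totient) + ∑ p ∈ P, 2 * (W * τ) := by
    rw [Finset.sum_add_distrib, ← Finset.mul_sum]
  rw [e8] at h8
  have h9 : ∑ p ∈ P, 2 * (W * τ) ≤ Y * (2 * (W * τ)) := by
    rw [Finset.sum_const, nsmul_eq_mul]
    gcongr
    calc #P ≤ #(Icc 1 Y) := Finset.card_le_card hPY
      _ = Y := by simp
  have h10 : WW (SS Z m) y ^ 2 * τ ≤ W * τ := by gcongr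
  rw [mul_sub]
  linarith

end St18


namespace St18

open Finset ArithmeticFunction

lemma tangent (s q lq : ℝ) (hs : 0 < s) (hq : 0 < q) (hlq : lq = Real.log q) : s * (1 + lq) - q ≤ s * Real.log s := by
  have h := Real.log_le_sub_one_of_pos (div_pos hq hs)
  rw [Real.log_div hq.ne' hs.ne'] at h
  have h2 := mul_le_mul_of_nonneg_left h hs.le
  have h3 : s * (q / s - 1) = q - s := by field_simp
  rw [h3] at h2
  rw [hlq]; linarith

lemma certificate (s : ℝ) (hs : 0 < s) (hs1 : s ≤ 1) :
    1 / 100 ≤ s * (1 + 5/14 - 10/7 * Real.log 2 + 5/7 * Real.log s - 5/42 * s) - 0.23 * (1.5 * s - 1) - 0.34 * (4/3 * s^2 - s) := by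
  have hL := Real.log_two_lt_d9
  set L := Real.log 2 with hLd
  have hsL : s * L ≤ s * 0.69315 := by gcongr; linarith
  have hr : Real.sqrt 2 ≤ 1.4143 := by
    rw [Real.sqrt_le_left (by norm_num)]; norm_num
  have t0 := tangent s 1 0 hs (by norm_num) (by simp)
  have t1 := tangent s (Real.sqrt 2 / 2) (-L/2) hs (by positivity) (by
    rw [Real.log_div (by positivity) (by norm_num), Real.log_sqrt (by norm_num), ← hLd]; ring)
  have t2 := tangent s (1/2) (-L) hs (by norm_num) (by
    rw [one_div, Real.log_inv])
  have t3 := tangent s (Real.sqrt 2 / 4) (-3*L/2) hs (by positivity) (by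
    rw [Real.log_div (by positivity) (by norm_num), Real.log_sqrt (by norm_num), show (4:ℝ) = 2^2 by norm_num, Real.log_pow, ← hLd]; push_cast; ring)
  have t4 := tangent s (1/4) (-2*L) hs (by norm_num) (by
    rw [one_div, Real.log_inv, show (4:ℝ) = 2^2 by norm_num, Real.log_pow]; push_cast; ring)
  have t6 := tangent s (1/8) (-3*L) hs (by norm_num) (by
    rw [one_div, Real.log_inv, show (8:ℝ) = 2^3 by norm_num, Real.log_pow]; push_cast; ring)
  set l := s * Real.log s
  have e : s * (1 + 5/14 - 10/7 * L + 5/7 * Real.log s - 5/42 * s) = s * (1 + 5/14) - 10/7 * (s * L) + 5/7 * l - 5/42 * s^2 := by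
    simp only [l]; ring
  rw [e]
  rcases le_total s 0.2 with h | h
  · nlinarith [mul_nonneg hs.le (sub_nonneg.mpr h)]
  rcases le_total s 0.29 with h' | h'
  · nlinarith [mul_nonneg (sub_nonneg.mpr h) (sub_nonneg.mpr h')]
  rcases le_total s 0.42 with h'' | h''
  · nlinarith [mul_nonneg (sub_nonneg.mpr h') (sub_nonneg.mpr h'')]
  rcases le_total s 0.59 with h3 | h3
  · nlinarith [mul_nonneg (sub_nonneg.mpr h'') (sub_nonneg.mpr h3)]
  rcases le_total s 0.84 with h4 | h4
  · nlinarith [mul_nonneg (sub_nonneg.mpr h3) (sub_nonneg.mpr h4)]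
  · nlinarith [mul_nonneg (sub_nonneg.mpr h4) (sub_nonneg.mpr hs1)]

/-- Primes with `log p ≤ y`. -/
noncomputable def PL (y : ℝ) : Finset ℕ := (pr ⌈Real.exp y⌉₊).filter (fun p : ℕ => Real.log p ≤ y)

lemma mem_PL {y : ℝ} {p : ℕ} : p ∈ PL y ↔ p.Prime ∧ Real.log p ≤ y := by
  simp only [PL, pr, mem_filter, mem_Icc]
  constructor
  · rintro ⟨⟨_, h⟩, h2⟩; exact ⟨h, h2⟩
  · rintro ⟨h, h2⟩
    refine ⟨⟨⟨h.one_le, ?_⟩, h⟩, h2⟩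
    have : (p:ℝ) ≤ Real.exp y := (Real.log_le_iff_le_exp (by exact_mod_cast h.pos)).mp h2
    exact_mod_cast this.trans (Nat.le_ceil _)

lemma mertens' : ∃ C : ℝ, 1 ≤ C ∧ ∀ s : ℝ, 0 ≤ s → 
    |∑ p ∈ PL s, Real.log p / p - s| ≤ C ∧ |∑ p ∈ PL s, Real.log p / ((p:ℝ) - 1) - s| ≤ C := by
  obtain ⟨C, hC, h⟩ := mertens
  refine ⟨C, hC, fun s hs => ?_⟩
  have hpos : 0 < ⌈Real.exp s⌉₊ := Nat.ceil_pos.mpr (Real.exp_pos s)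
  refine h ⌈Real.exp s⌉₊ hpos s hs ?_
  rw [Real.le_log_iff_exp_le (by exact_mod_cast hpos)]
  exact Nat.le_ceil _

lemma PL_filter (y s : ℝ) (h : s ≤ y) : (PL y).filter (fun p : ℕ => Real.log p ≤ s) = PL s := by
  ext p
  simp only [mem_filter, mem_PL]
  exact ⟨fun h' => ⟨h'.1.1, h'.2⟩, fun h' => ⟨⟨h'.1, h'.2.trans h⟩, h'.2⟩⟩

lemma log_prime_pos {p : ℕ} (h : p.Prime) : 0 < Real.log p := Real.log_pos (by exact_mod_cast h.one_lt)

lemma wsum1 : ∃ C : ℝ, 0 ≤ C ∧ ∀ y t : ℝ, 0 < t → t ≤ y →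
    ∑ p ∈ PL t, Real.log p / p * (Real.log p - Real.log p ^ 2 / y) ≤ t^2/2 - t^3/(3*y) + C * t := by
  obtain ⟨C, hC, h⟩ := mertens'
  refine ⟨2 * C, by linarith, fun y t ht hty => ?_⟩
  have hy : 0 < y := ht.trans_le hty
  have := abel (PL t) (fun p => Real.log p / p) (fun p => Real.log p) 0 t C ht.le (fun u => u - u^2/y) (fun u => 1 - 2*u/y)
    (fun u => u^2/2 - u^3/(3*y)) (fun _ => 1) (fun u => u) ?_ ?_ ?_ ?_ ?_ ?_ ?_ ?_
  · have h1 : |t - t^2/y| ≤ t := by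
      have : t^2/y ≤ t := by rw [div_le_iff₀ hy]; nlinarith
      have : 0 ≤ t^2/y := by positivity
      rw [abs_le]; constructor <;> linarith
    have h2 : C * (|t - t^2/y| + (t - 0)) ≤ C * (t + (t - 0)) := by gcongr
    have e : t^2/2 - t^3/(3*y) - ((0:ℝ)^2/2 - 0^3/(3*y)) = t^2/2 - t^3/(3*y) := by ring
    rw [e] at this
    linarith
  · intro s _
    have h1 := (hasDerivAt_id s).sub (((hasDerivAt_id s).pow 2).div_const y)
    refine HasDerivAt.congr_deriv h1 ?_
    simp
  · fun_prop
  · intro s _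
    have h1 := (((hasDerivAt_id s).pow 2).div_const 2).sub (((hasDerivAt_id s).pow 3).div_const (3*y))
    refine HasDerivAt.congr_deriv h1 ?_
    simp; field_simp
  · intro s _; exact hasDerivAt_id s
  · fun_prop
  · intro s hs
    have h1 : 2 * s / y ≤ 2 := by rw [div_le_iff₀ hy]; linarith [hs.2]
    have h2 : 0 ≤ 2 * s / y := by have := hs.1; positivity
    rw [abs_le]; constructor <;> linarith
  · intro p hp
    have := mem_PL.mp hp
    exact ⟨log_prime_pos this.1, this.2⟩
  · intro s hs
    rw [PL_filter t s hs.2, sub_zero]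
    exact (h s hs.1).1

lemma wsum2 : ∃ C : ℝ, 0 ≤ C ∧ ∀ y t : ℝ, 0 < t → t ≤ y →
    ∑ p ∈ (PL y).filter (fun p : ℕ => ¬ Real.log p ≤ t), Real.log p / p * (t^2 * (1 / Real.log p - 1 / y)) ≤ t^2 * (Real.log (y / t) - 1 + t / y) + C * t := by
  obtain ⟨C, hC, h⟩ := mertens'
  refine ⟨2 * C, by linarith, fun y t ht hty => ?_⟩
  have hy : 0 < y := ht.trans_le hty
  have := abel ((PL y).filter (fun p : ℕ => ¬ Real.log p ≤ t)) (fun p => Real.log p / p) (fun p => Real.log p) t y (2 * C) hty 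
    (fun u => t^2 * (1/u - 1/y)) (fun u => - (t^2 / u^2))
    (fun u => t^2 * (Real.log u - u / y)) (fun u => t^2 / u^2) (fun u => - (t^2 / u)) ?_ ?_ ?_ ?_ ?_ ?_ ?_ ?_
  · simp only [sub_self, mul_zero, abs_zero, zero_add] at this
    have e1 : -(t^2/y) - -(t^2/t) ≤ t := by
      have : t^2/t = t := by field_simp
      have : 0 ≤ t^2/y := by positivity
      linarith
    have h2 : 2 * C * (-(t^2/y) - -(t^2/t)) ≤ 2 * C * t := by gcongr
    have e2 : t^2 * (Real.log y - y / y) - t^2 * (Real.log t - t / y) = t^2 * (Real.log (y / t) - 1 + t / y) := by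
      rw [Real.log_div hy.ne' ht.ne', div_self hy.ne']; ring
    linarith
  · intro s hs
    have hs0 : s ≠ 0 := (ht.trans_le hs.1).ne'
    have h1 := ((hasDerivAt_inv hs0).sub_const (1/y)).const_mul (t^2)
    simp only [one_div] at h1 ⊢
    refine HasDerivAt.congr_deriv h1 ?_
    field_simp
  · apply ContinuousOn.neg
    apply ContinuousOn.div continuousOn_const (by fun_prop)
    intro s hs
    exact pow_ne_zero _ (ht.trans_le hs.1).ne'
  · intro s hs
    have hs0 : s ≠ 0 := (ht.trans_le hs.1).ne'
    have h1 := ((Real.hasDerivAt_log hs0).sub ((hasDerivAt_id s).div_const y)).const_mul (t^2)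
    refine HasDerivAt.congr_deriv h1 ?_
    simp
  · intro s hs
    have hs0 : s ≠ 0 := (ht.trans_le hs.1).ne'
    have h1 := ((hasDerivAt_inv hs0).const_mul (t^2)).neg
    refine HasDerivAt.congr_deriv h1 ?_
    field_simp
  · apply ContinuousOn.div continuousOn_const (by fun_prop)
    intro s hs
    exact pow_ne_zero _ (ht.trans_le hs.1).ne'
  · intro s hs
    rw [abs_neg, abs_of_nonneg (by positivity)]
  · intro p hp
    have := mem_filter.mp hp
    exact ⟨not_le.mp this.2, (mem_PL.mp this.1).2⟩
  · intro s hs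
    have e : ∑ p ∈ ((PL y).filter (fun p : ℕ => ¬ Real.log p ≤ t)).filter (fun p : ℕ => Real.log p ≤ s), Real.log p / p =
       ∑ p ∈ PL s, Real.log p / p - ∑ p ∈ PL t, Real.log p / p := by
      rw [Finset.filter_filter]
      have : (PL y).filter (fun p : ℕ => ¬ Real.log p ≤ t ∧ Real.log p ≤ s) = (PL s).filter (fun p : ℕ => ¬ Real.log p ≤ t) := by
        rw [← PL_filter y s hs.2, Finset.filter_filter]
        apply Finset.filter_congr; intros; tauto
      rw [this, ← Finset.sum_filter_add_sum_filter_not (PL s) (fun p : ℕ => Real.log p ≤ t), PL_filter s t hs.1]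
      ring
    have e' := e
    have a1 := (h s (ht.le.trans hs.1)).1
    have a2 := (h t ht.le).1
    rw [abs_le] at a1 a2 ⊢
    rw [e]
    constructor <;> linarith [a1.1, a1.2, a2.1, a2.2]

lemma wsum : ∃ C : ℝ, 0 ≤ C ∧ ∀ y t : ℝ, 0 < t → t ≤ y →
    ∑ p ∈ PL y, (5/7 * (1 - Real.log p / y) / p + 1 / (p:ℝ)^2) * (min (Real.log p) t) ^ 2 ≤ 
      5/7 * (t^2 * (Real.log (y/t) - 1/2 + 2*t/(3*y))) + C * t := by
  obtain ⟨C1, hC1, h1⟩ := wsum1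
  obtain ⟨C2, hC2, h2⟩ := wsum2
  obtain ⟨C3, hC3, h3⟩ := log_div_sum_bdd
  refine ⟨5/7 * (C1 + C2) + C3, by positivity, fun y t ht hty => ?_⟩
  have hy : 0 < y := ht.trans_le hty
  have b1 := h1 y t ht hty
  have b2 := h2 y t ht hty
  have b3 := h3 (PL y) (fun p hp => (mem_PL.mp hp).1.two_le)
  have e1 : ∑ p ∈ PL y, ((1 - Real.log p / y) / p) * (min (Real.log p) t) ^ 2 = 
     ∑ p ∈ PL t, Real.log p / p * (Real.log p - Real.log p ^ 2 / y) + 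
     ∑ p ∈ (PL y).filter (fun p : ℕ => ¬ Real.log p ≤ t), Real.log p / p * (t^2 * (1 / Real.log p - 1 / y)) := by
    rw [← Finset.sum_filter_add_sum_filter_not (PL y) (fun p : ℕ => Real.log p ≤ t), PL_filter y t hty]
    congr 1
    · apply Finset.sum_congr rfl
      intro p hp
      rw [min_eq_left (mem_PL.mp hp).2]; ring
    · apply Finset.sum_congr rfl
      intro p hp
      have hp' := mem_filter.mp hp
      have hlp := log_prime_pos (mem_PL.mp hp'.1).1
      have hp0 : (p:ℝ) ≠ 0 := by exact_mod_cast (mem_PL.mp hp'.1).1.ne_zero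
      rw [min_eq_right (not_le.mp hp'.2).le]
      field_simp
  have e2 : ∑ p ∈ PL y, (1 / (p:ℝ)^2) * (min (Real.log p) t) ^ 2 ≤ t * C3 := by
    calc _ ≤ ∑ p ∈ PL y, t * (Real.log p / (p * (p - 1))) := by
          apply Finset.sum_le_sum
          intro p hp
          have hp' := (mem_PL.mp hp).1
          have hlp := log_prime_pos hp'
          have hp2 : (2:ℝ) ≤ p := by exact_mod_cast hp'.two_le
          have m1 : (min (Real.log p) t) ^ 2 ≤ Real.log p * t := by
            rw [sq]
            exact mul_le_mul (min_le_left _ _) (min_le_right _ _) (by positivity) hlp.le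
          calc _ ≤ 1 / ((p:ℝ) * (p - 1)) * (Real.log p * t) := by
                gcongr
                · have : (0:ℝ) < p - 1 := by linarith
                  positivity
                · have : (0:ℝ) < p - 1 := by linarith
                  positivity
                · nlinarith only [hp2]
            _ = _ := by ring
      _ ≤ _ := by rw [← Finset.mul_sum]; gcongr
  have e3 : ∑ p ∈ PL y, (5/7 * (1 - Real.log p / y) / p + 1 / (p:ℝ)^2) * (min (Real.log p) t) ^ 2 = 
     5/7 * ∑ p ∈ PL y, ((1 - Real.log p / y) / p) * (min (Real.log p) t) ^ 2 + ∑ p ∈ PL y, (1 / (p:ℝ)^2) * (min (Real.log p) t) ^ 2 := by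
    rw [Finset.mul_sum, ← Finset.sum_add_distrib]
    apply Finset.sum_congr rfl
    intros; ring
  rw [e3, e1]
  have e4 : t^2/2 - t^3/(3*y) + t^2 * (Real.log (y / t) - 1 + t / y) = t^2 * (Real.log (y/t) - 1/2 + 2*t/(3*y)) := by
    field_simp; ring
  nlinarith

lemma key_sum1 : ∃ C : ℝ, 0 ≤ C ∧ ∀ t : ℝ, 0 ≤ t → 
    ∑ p ∈ PL t, Real.log p / ((p:ℝ) - 1) * (t - Real.log p) ≤ t^2/2 + C * t := by
  obtain ⟨C, hC, h⟩ := mertens'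
  refine ⟨C, by linarith, fun t ht => ?_⟩
  have := abel (PL t) (fun p => Real.log p / ((p:ℝ) - 1)) (fun p => Real.log p) 0 t C ht (fun u => t - u) (fun u => -1)
    (fun u => t * u - u^2/2) (fun _ => 1) (fun u => u) ?_ ?_ ?_ ?_ ?_ ?_ ?_ ?_
  · simp only [sub_self, abs_zero] at this
    linarith
  · intro s _
    exact (hasDerivAt_id s).const_sub t
  · fun_prop
  · intro s _
    have h1 := ((hasDerivAt_id s).const_mul t).sub (((hasDerivAt_id s).pow 2).div_const 2)
    refine HasDerivAt.congr_deriv h1 ?_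
    simp
  · intro s _; exact hasDerivAt_id s
  · fun_prop
  · intro s hs; simp
  · intro p hp
    have := mem_PL.mp hp
    exact ⟨log_prime_pos this.1, this.2⟩
  · intro s hs
    rw [PL_filter t s hs.2, sub_zero]
    exact (h s hs.1).2

lemma key_sum2 : ∃ C : ℝ, 0 ≤ C ∧ ∀ t : ℝ, 0 ≤ t → 
    ∑ p ∈ PL t, Real.log p / ((p:ℝ) - 1) * (t - Real.log p)^2 ≤ t^3/3 + C * t^2 := by
  obtain ⟨C, hC, h⟩ := mertens'
  refine ⟨C, by linarith, fun t ht => ?_⟩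
  have := abel (PL t) (fun p => Real.log p / ((p:ℝ) - 1)) (fun p => Real.log p) 0 t C ht (fun u => (t - u)^2) (fun u => -(2*(t-u)))
    (fun u => -((t - u)^3/3)) (fun u => 2*(t-u)) (fun u => -(t-u)^2) ?_ ?_ ?_ ?_ ?_ ?_ ?_ ?_
  · simp only [sub_self, abs_zero, sub_zero] at this
    norm_num at this
    linarith
  · intro s _
    have h1 := ((hasDerivAt_id s).const_sub t).pow 2
    refine HasDerivAt.congr_deriv h1 ?_
    simp
  · fun_prop
  · intro s _
    have h1 := ((((hasDerivAt_id s).const_sub t).pow 3).div_const 3).neg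
    refine HasDerivAt.congr_deriv h1 ?_
    simp
    ring
  · intro s _
    have h1 := (((hasDerivAt_id s).const_sub t).pow 2).neg
    refine HasDerivAt.congr_deriv h1 ?_
    simp
  · fun_prop
  · intro s hs
    rw [abs_neg, abs_of_nonneg (by linarith [hs.2])]
  · intro p hp
    have := mem_PL.mp hp
    exact ⟨log_prime_pos this.1, this.2⟩
  · intro s hs
    rw [PL_filter t s hs.2, sub_zero]
    exact (h s hs.1).2

end St18


namespace St18

open Finset ArithmeticFunction

lemma log_squarefree (r : ℕ) (hr : Squarefree r) : Real.log r = ∑ p ∈ r.primeFactors, Real.log p := by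
  conv_lhs => rw [← Nat.prod_primeFactors_of_squarefree hr]
  push_cast
  rw [Real.log_prod]
  intro p hp
  exact_mod_cast (Nat.prime_of_mem_primeFactors hp).ne_zero

lemma log_le_of_SS {Z m r : ℕ} {ℓ : ℝ} (hZ : (Z:ℝ) ≤ Real.exp ℓ) (hr : r ∈ SS Z m) : Real.log r ≤ ℓ := by
  have h := (mem_SS.mp hr).1
  rw [Real.log_le_iff_le_exp (by exact_mod_cast h.1)]
  exact le_trans (by exact_mod_cast h.2) hZ

lemma key_ineq (ℓ : ℝ) (Z m : ℕ) (hZ : (Z:ℝ) ≤ Real.exp ℓ) (g : ℝ → ℝ) (hg : ∀ u, 0 ≤ u → 0 ≤ g u) :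
    ∑ r ∈ SS Z m, 1 / (r.totient:ℝ) * (Real.log r * g (ℓ - Real.log r)) ≤
    ∑ r ∈ SS Z m, 1 / (r.totient:ℝ) * ∑ p ∈ PL (ℓ - Real.log r), Real.log p / ((p:ℝ) - 1) * g (ℓ - Real.log r - Real.log p) := by
  have h1 : ∑ r ∈ SS Z m, 1 / (r.totient:ℝ) * (Real.log r * g (ℓ - Real.log r)) = 
      ∑ r ∈ SS Z m, ∑ p ∈ r.primeFactors, 1 / (r.totient:ℝ) * (Real.log p * g (ℓ - Real.log r)) := by
    apply Finset.sum_congr rfl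
    intro r hr
    conv_lhs => rw [log_squarefree r (mem_SS.mp hr).2.1]
    rw [← log_squarefree r (mem_SS.mp hr).2.1, ← Finset.mul_sum, ← Finset.sum_mul, ← log_squarefree r (mem_SS.mp hr).2.1]
  simp_rw [Finset.mul_sum]
  rw [h1, Finset.sum_sigma', Finset.sum_sigma']
  set D := (SS Z m).sigma fun r => r.primeFactors
  set T := (SS Z m).sigma fun r => PL (ℓ - Real.log r)
  let φ : (Σ _ : ℕ, ℕ) → (Σ _ : ℕ, ℕ) := fun x => ⟨x.1 / x.2, x.2⟩
  have hD : ∀ x ∈ D, ∃ k : ℕ, x.1 = x.2 * k ∧ x.2.Prime ∧ Nat.Coprime x.2 k ∧ k ∈ SS Z m ∧ x.1 ∈ SS Z m ∧ 0 < k := by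
    intro x hx
    obtain ⟨hr, hp⟩ := Finset.mem_sigma.mp hx
    have hpp := Nat.prime_of_mem_primeFactors hp
    obtain ⟨k, hk⟩ := Nat.dvd_of_mem_primeFactors hp
    have hr' := hr
    rw [hk] at hr'
    obtain ⟨⟨a1, a2⟩, a3, a4⟩ := mem_SS.mp hr'
    have hk0 : 0 < k := Nat.pos_of_mul_pos_left a1
    refine ⟨k, hk, hpp, Nat.coprime_of_squarefree_mul a3, ?_, hr, hk0⟩
    exact mem_SS.mpr ⟨⟨hk0, (Nat.le_mul_of_pos_left k hpp.pos).trans a2⟩, a3.squarefree_of_dvd (dvd_mul_left _ _), a4.coprime_dvd_left (dvd_mul_left _ _)⟩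
  have hinj : Set.InjOn φ D := by
    intro x hx y hy hxy
    obtain ⟨k, hk, hkp, _⟩ := hD x hx
    obtain ⟨l, hl, hlp, _⟩ := hD y hy
    obtain ⟨x1, x2⟩ := x
    obtain ⟨y1, y2⟩ := y
    simp only [φ, Sigma.mk.injEq, heq_eq_eq] at hxy hk hl hkp hlp
    obtain ⟨e1, rfl⟩ := hxy
    rw [hk, hl, Nat.mul_div_cancel_left _ hkp.pos, Nat.mul_div_cancel_left _ hkp.pos] at e1
    rw [hk, hl, e1]
  have hval : ∀ x ∈ D, 1 / ((x.1.totient : ℕ):ℝ) * (Real.log x.2 * g (ℓ - Real.log x.1)) = 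
     1 / (((φ x).1.totient : ℕ):ℝ) * (Real.log (φ x).2 / (((φ x).2:ℝ) - 1) * g (ℓ - Real.log (φ x).1 - Real.log (φ x).2)) := by
    intro x hx
    obtain ⟨k, hk, hkp, hc, hkS, hxS, hk0⟩ := hD x hx
    obtain ⟨x1, x2⟩ := x
    simp only [φ] at hk hkp hc ⊢
    rw [hk, Nat.mul_div_cancel_left _ hkp.pos, Nat.totient_mul hc, Nat.totient_prime hkp]
    have hp2 : (2:ℝ) ≤ x2 := by exact_mod_cast hkp.two_le
    have hp0 : (x2:ℝ) ≠ 0 := by linarith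
    have hk0' : (k:ℝ) ≠ 0 := by exact_mod_cast hk0.ne'
    have ht : (k.totient : ℝ) ≠ 0 := by
        exact_mod_cast (Nat.totient_pos.mpr hk0).ne'
    have hp1 : (x2:ℝ) - 1 ≠ 0 := by linarith
    push_cast [Nat.cast_sub hkp.one_le]
    rw [Real.log_mul hp0 hk0', show ℓ - (Real.log x2 + Real.log k) = ℓ - Real.log k - Real.log x2 by ring]
    field_simp
  rw [Finset.sum_congr rfl hval, ← Finset.sum_image (g := φ) (f := fun x : (Σ _ : ℕ, ℕ) => 1 / ((x.1.totient : ℕ):ℝ) * (Real.log x.2 / ((x.2:ℝ) - 1) * g (ℓ - Real.log x.1 - Real.log x.2))) hinj]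
  apply Finset.sum_le_sum_of_subset_of_nonneg
  · intro y hy
    obtain ⟨x, hx, rfl⟩ := Finset.mem_image.mp hy
    obtain ⟨k, hk, hkp, hc, hkS, hxS, hk0⟩ := hD x hx
    obtain ⟨x1, x2⟩ := x
    simp only [φ, T, Finset.mem_sigma] at hk hkp hc hxS ⊢
    have h2 := log_le_of_SS hZ hxS
    have hp0 : (x2:ℝ) ≠ 0 := by exact_mod_cast hkp.ne_zero
    have hk0' : (k:ℝ) ≠ 0 := by exact_mod_cast hk0.ne'
    rw [hk, Nat.cast_mul, Real.log_mul hp0 hk0'] at h2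
    rw [hk, Nat.mul_div_cancel_left _ hkp.pos]
    exact ⟨hkS, mem_PL.mpr ⟨hkp, by linarith⟩⟩
  · intro x hx _
    obtain ⟨hr, hp⟩ := Finset.mem_sigma.mp hx
    obtain ⟨hpp, hl⟩ := mem_PL.mp hp
    have := hg (ℓ - Real.log x.1 - Real.log x.2) (by linarith)
    have h2 := log_prime_pos hpp
    have hp2 : (2:ℝ) ≤ x.2 := by exact_mod_cast hpp.two_le
    have : (0:ℝ) < x.2 - 1 := by linarith
    positivity

lemma main_Q : ∃ ℓ0 : ℝ, 1 ≤ ℓ0 ∧ ∀ ℓ : ℝ, ℓ0 ≤ ℓ → ∀ m : ℕ, 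
    1 ≤ ∑ r ∈ SS ⌊Real.exp ℓ⌋₊ m, 1 / (r.totient:ℝ) * ((ℓ - Real.log r)^2 - 
        ∑ p ∈ PL (4 * ℓ), (5/7 * (1 - Real.log p / (4*ℓ)) / p + 1 / (p:ℝ)^2) * (min (Real.log p) (ℓ - Real.log r)) ^ 2) := by
  obtain ⟨C1, hC1, h1⟩ := wsum
  obtain ⟨C2, hC2, h2⟩ := key_sum1
  obtain ⟨C3, hC3, h3⟩ := key_sum2
  set C := C1 + C2 + C3 + 1 with hC
  refine ⟨100 * C + 100, by linarith, fun ℓ hℓ m => ?_⟩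
  have hℓ0 : 0 < ℓ := by linarith
  have hZ : ((⌊Real.exp ℓ⌋₊ : ℕ):ℝ) ≤ Real.exp ℓ := Nat.floor_le (Real.exp_pos _).le
  set Z := ⌊Real.exp ℓ⌋₊ with hZd
  -- pointwise bound
  have hpt : ∀ r ∈ SS Z m, (1/100 * ℓ - C1) * (ℓ - Real.log r) + 0.23 * (1.5 * (ℓ - Real.log r)^2 - ℓ * (ℓ - Real.log r)) + 
      0.34 / ℓ * (4/3 * (ℓ - Real.log r)^3 - ℓ * (ℓ - Real.log r)^2) ≤ (ℓ - Real.log r)^2 - 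
        ∑ p ∈ PL (4 * ℓ), (5/7 * (1 - Real.log p / (4*ℓ)) / p + 1 / (p:ℝ)^2) * (min (Real.log p) (ℓ - Real.log r)) ^ 2 := by
    intro r hr
    have hlr := log_le_of_SS hZ hr
    have hr1 : 0 ≤ Real.log r := Real.log_natCast_nonneg r
    set t := ℓ - Real.log r with ht
    have ht0 : 0 ≤ t := by linarith
    rcases ht0.eq_or_lt with h0 | h0
    · rw [← h0]
      have : ∀ p ∈ PL (4 * ℓ), (5/7 * (1 - Real.log p / (4*ℓ)) / p + 1 / (p:ℝ)^2) * (min (Real.log p) 0) ^ 2 = 0 := by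
        intro p _
        rw [min_eq_right (Real.log_natCast_nonneg p)]; ring
      rw [Finset.sum_eq_zero this]; simp
    · have a1 := h1 (4 * ℓ) t h0 (by linarith)
      have hs : 0 < t / ℓ := by positivity
      have hs1 : t / ℓ ≤ 1 := by rw [div_le_one hℓ0]; linarith
      have a2 := certificate (t / ℓ) hs hs1
      set s := t / ℓ with hsd
      have hts : t = s * ℓ := by rw [hsd]; field_simp
      have e1 : Real.log (4 * ℓ / t) = 2 * Real.log 2 - Real.log s := by
        rw [show 4 * ℓ / t = 2^2 / s by rw [hsd]; field_simp; norm_num, Real.log_div (by norm_num) hs.ne', Real.log_pow]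
        push_cast; ring
      have e2 : 2 * t / (3 * (4 * ℓ)) = s / 6 := by rw [hsd]; field_simp; norm_num
      rw [e1, e2] at a1
      have a3 := mul_le_mul_of_nonneg_left a2 (show 0 ≤ ℓ^2 * s by positivity)
      have e3 : 0.34 / ℓ * (4/3 * t^3 - ℓ * t^2) = 0.34 * ℓ^2 * (4/3 * s^3 - s^2) := by
        rw [hts]; field_simp
      rw [e3]
      rw [hts] at a1 ⊢
      nlinarith [a1, a3]
  have k1 := key_ineq ℓ Z m hZ (fun u => u) (fun u hu => hu)
  have k2 := key_ineq ℓ Z m hZ (fun u => u^2) (fun u hu => by positivity)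
  have k1' : 0 ≤ ∑ r ∈ SS Z m, 1 / (r.totient:ℝ) * (1.5 * (ℓ - Real.log r)^2 - ℓ * (ℓ - Real.log r) + C2 * (ℓ - Real.log r)) := by
    have : ∑ r ∈ SS Z m, 1 / (r.totient:ℝ) * (1.5 * (ℓ - Real.log r)^2 - ℓ * (ℓ - Real.log r) + C2 * (ℓ - Real.log r)) = 
       ∑ r ∈ SS Z m, 1 / (r.totient:ℝ) * ((ℓ - Real.log r)^2/2 + C2 * (ℓ - Real.log r)) - ∑ r ∈ SS Z m, 1 / (r.totient:ℝ) * (Real.log r * (ℓ - Real.log r)) := by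
      rw [← Finset.sum_sub_distrib]; apply Finset.sum_congr rfl; intros; ring
    rw [this, sub_nonneg]
    refine k1.trans (Finset.sum_le_sum fun r hr => ?_)
    have hlr := log_le_of_SS hZ hr
    gcongr
    exact h2 _ (by linarith)
  have k2' : 0 ≤ ∑ r ∈ SS Z m, 1 / (r.totient:ℝ) * (4/3 * (ℓ - Real.log r)^3 - ℓ * (ℓ - Real.log r)^2 + C3 * (ℓ - Real.log r)^2) := by
    have : ∑ r ∈ SS Z m, 1 / (r.totient:ℝ) * (4/3 * (ℓ - Real.log r)^3 - ℓ * (ℓ - Real.log r)^2 + C3 * (ℓ - Real.log r)^2) = 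
       ∑ r ∈ SS Z m, 1 / (r.totient:ℝ) * ((ℓ - Real.log r)^3/3 + C3 * (ℓ - Real.log r)^2) - ∑ r ∈ SS Z m, 1 / (r.totient:ℝ) * (Real.log r * (ℓ - Real.log r)^2) := by
      rw [← Finset.sum_sub_distrib]; apply Finset.sum_congr rfl; intros; ring
    rw [this, sub_nonneg]
    refine k2.trans (Finset.sum_le_sum fun r hr => ?_)
    have hlr := log_le_of_SS hZ hr
    gcongr
    exact h3 _ (by linarith)
  have hterm : ∀ r ∈ SS Z m, 1 / (r.totient:ℝ) * (ℓ - Real.log r) + 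
      0.23 * (1 / (r.totient:ℝ) * (1.5 * (ℓ - Real.log r)^2 - ℓ * (ℓ - Real.log r) + C2 * (ℓ - Real.log r))) +
      0.34 / ℓ * (1 / (r.totient:ℝ) * (4/3 * (ℓ - Real.log r)^3 - ℓ * (ℓ - Real.log r)^2 + C3 * (ℓ - Real.log r)^2)) ≤ 
      1 / (r.totient:ℝ) * ((ℓ - Real.log r)^2 - 
        ∑ p ∈ PL (4 * ℓ), (5/7 * (1 - Real.log p / (4*ℓ)) / p + 1 / (p:ℝ)^2) * (min (Real.log p) (ℓ - Real.log r)) ^ 2) := by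
    intro r hr
    have hp := hpt r hr
    have hlr := log_le_of_SS hZ hr
    have hr1 : 0 ≤ Real.log r := Real.log_natCast_nonneg r
    set t := ℓ - Real.log r with ht
    have ht0 : 0 ≤ t := by linarith
    have htl : t ≤ ℓ := by linarith
    have hh : (0:ℝ) ≤ 1 / (r.totient:ℝ) := by positivity
    have e : 1 / (r.totient:ℝ) * t + 0.23 * (1 / (r.totient:ℝ) * (1.5 * t^2 - ℓ * t + C2 * t)) +
      0.34 / ℓ * (1 / (r.totient:ℝ) * (4/3 * t^3 - ℓ * t^2 + C3 * t^2)) = 1 / (r.totient:ℝ) * (t + 0.23 * (1.5 * t^2 - ℓ * t + C2 * t) + 0.34 / ℓ * (4/3 * t^3 - ℓ * t^2 + C3 * t^2)) := by ring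
    rw [e]
    apply mul_le_mul_of_nonneg_left _ hh
    refine le_trans ?_ hp
    have b1 : 0.34 / ℓ * (C3 * t^2) ≤ C3 * t := by
      rw [div_mul_eq_mul_div, div_le_iff₀ hℓ0]
      have : t^2 ≤ t * ℓ := by rw [sq]; gcongr
      nlinarith [mul_nonneg hC3 (mul_nonneg ht0 hℓ0.le), mul_le_mul_of_nonneg_left this hC3]
    have b2 : (C + 1) * t ≤ 1/100 * ℓ * t := by gcongr; linarith
    have b3 : 0 ≤ C2 * t := by positivity
    rw [hC] at b2
    linarith
  refine le_trans ?_ (Finset.sum_le_sum hterm)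
  rw [Finset.sum_add_distrib, Finset.sum_add_distrib, ← Finset.mul_sum, ← Finset.mul_sum]
  have h1m : (1:ℕ) ∈ SS Z m := by
    refine mem_SS.mpr ⟨⟨le_refl _, ?_⟩, squarefree_one, Nat.coprime_one_left m⟩
    rw [hZd]
    apply Nat.le_floor
    simpa using Real.one_le_exp hℓ0.le
  have hs : ℓ ≤ ∑ r ∈ SS Z m, 1 / (r.totient:ℝ) * (ℓ - Real.log r) := by
    have := Finset.single_le_sum (f := fun r : ℕ => 1 / (r.totient:ℝ) * (ℓ - Real.log r)) (s := SS Z m) (fun r hr => by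
      have hlr := log_le_of_SS hZ hr
      have : 0 ≤ ℓ - Real.log r := by linarith
      positivity) h1m
    simpa using this
  have q1 : 0 ≤ 0.34 / ℓ * ∑ r ∈ SS Z m, 1 / (r.totient:ℝ) * (4/3 * (ℓ - Real.log r)^3 - ℓ * (ℓ - Real.log r)^2 + C3 * (ℓ - Real.log r)^2) := by
    positivity
  linarith

end St18


namespace St18

open Finset ArithmeticFunction

/-- sieve weight profile -/
noncomputable def yy (ℓ : ℝ) (r : ℕ) : ℝ := max (ℓ - Real.log r) 0

/-- prime weights -/
noncomputable def wt (ℓ : ℝ) (p : ℕ) : ℝ := 5/7 * (1 - Real.log p / (4*ℓ))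

/-- sieving primes coprime to the modulus -/
noncomputable def PS (ℓ : ℝ) (m : ℕ) : Finset ℕ := (PL (4 * ℓ)).filter (fun p => Nat.Coprime p m)

lemma yy_zero (ℓ : ℝ) (r : ℕ) (h : ⌊Real.exp ℓ⌋₊ < r) : yy ℓ r = 0 := by
  unfold yy
  apply max_eq_right
  have h1 : Real.exp ℓ < r := Nat.lt_of_floor_lt h
  have h2 : ℓ < Real.log r := (Real.lt_log_iff_exp_lt ((Real.exp_pos _).trans h1)).mpr h1
  linarith

lemma yy_abs (ℓ : ℝ) (hℓ : 0 ≤ ℓ) (r : ℕ) : |yy ℓ r| ≤ ℓ := by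
  unfold yy
  rw [abs_of_nonneg (le_max_right _ _)]
  exact max_le (by linarith [Real.log_natCast_nonneg r]) hℓ

lemma yy_nonneg (ℓ : ℝ) (r : ℕ) : 0 ≤ yy ℓ r := le_max_right _ _

lemma sh_abs (ℓ : ℝ) (hℓ : 0 ≤ ℓ) (p r : ℕ) : |sh p (yy ℓ) r| ≤ ℓ := by
  unfold sh
  split_ifs
  · simpa
  · have h1 := (abs_le.mp (yy_abs ℓ hℓ r)).2
    have h2 := (abs_le.mp (yy_abs ℓ hℓ (p * r))).2
    have h3 := yy_nonneg ℓ r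
    have h4 := yy_nonneg ℓ (p * r)
    rw [abs_le]; constructor <;> linarith

lemma sh_sq {ℓ : ℝ} {p r : ℕ} (hp : p.Prime) (hr : 0 < r) (h : Real.log r ≤ ℓ) : sh p (yy ℓ) r ^ 2 ≤ (min (Real.log p) (ℓ - Real.log r))^2 := by
  have hlp := log_prime_pos hp
  unfold sh
  split_ifs
  · have : 0 ≤ min (Real.log p) (ℓ - Real.log r) := le_min hlp.le (by linarith)
    rw [zero_pow (by norm_num)]
    exact sq_nonneg _
  · unfold yy
    have hp0 : (p:ℝ) ≠ 0 := by exact_mod_cast hp.ne_zero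
    have hr0 : (r:ℝ) ≠ 0 := by exact_mod_cast hr.ne'
    rw [max_eq_left (by linarith), Nat.cast_mul, Real.log_mul hp0 hr0]
    rcases le_total (Real.log p) (ℓ - Real.log r) with h' | h'
    · rw [min_eq_left h', max_eq_left (by linarith)]
      apply le_of_eq; ring
    · rw [min_eq_right h', max_eq_right (by linarith)]
      apply le_of_eq; ring

lemma wt_bounds {ℓ : ℝ} (hℓ : 0 < ℓ) {p : ℕ} (hp : p ∈ PL (4 * ℓ)) : 0 ≤ wt ℓ p ∧ wt ℓ p ≤ 1 := by
  obtain ⟨h1, h2⟩ := mem_PL.mp hp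
  have h3 := log_prime_pos h1
  have h4 : Real.log p / (4 * ℓ) ≤ 1 := by rw [div_le_one (by positivity)]; exact h2
  have h5 : 0 ≤ Real.log p / (4 * ℓ) := by positivity
  unfold wt
  constructor <;> linarith

lemma Q_bound : ∃ ℓ0 : ℝ, 1 ≤ ℓ0 ∧ ∀ ℓ : ℝ, ℓ0 ≤ ℓ → ∀ m : ℕ, 
    1 ≤ ∑ r ∈ SS ⌊Real.exp ℓ⌋₊ m, yy ℓ r ^ 2 / r.totient - 
      ∑ p ∈ PS ℓ m, (wt ℓ p / p + 1 / (p:ℝ)^2) * ∑ r ∈ SS ⌊Real.exp ℓ⌋₊ m, sh p (yy ℓ) r ^ 2 / r.totient := by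
  obtain ⟨ℓ0, h0, h⟩ := main_Q
  refine ⟨ℓ0, h0, fun ℓ hℓ m => ?_⟩
  have hℓ0 : 0 < ℓ := by linarith
  have hZ : ((⌊Real.exp ℓ⌋₊ : ℕ):ℝ) ≤ Real.exp ℓ := Nat.floor_le (Real.exp_pos _).le
  refine (h ℓ hℓ m).trans ?_
  simp_rw [Finset.mul_sum]
  rw [Finset.sum_comm, ← Finset.sum_sub_distrib]
  apply Finset.sum_le_sum
  intro r hr
  have hlr := log_le_of_SS hZ hr
  have e1 : yy ℓ r ^ 2 / r.totient - ∑ p ∈ PS ℓ m, (wt ℓ p / p + 1 / (p:ℝ)^2) * (sh p (yy ℓ) r ^ 2 / r.totient) = 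
     1 / (r.totient:ℝ) * (yy ℓ r ^ 2 - ∑ p ∈ PS ℓ m, (wt ℓ p / p + 1 / (p:ℝ)^2) * (sh p (yy ℓ) r ^ 2)) := by
    rw [mul_sub, Finset.mul_sum]
    congr 1
    · ring
    · apply Finset.sum_congr rfl; intros; ring
  rw [e1]
  gcongr
  · unfold yy; exact le_max_left _ _
  · unfold PS
    rw [Finset.sum_filter]
    apply Finset.sum_le_sum
    intro p hp
    have hw := (wt_bounds hℓ0 hp).1
    have hww : 0 ≤ (wt ℓ p / p + 1 / (p:ℝ)^2) := by positivity
    split_ifs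
    · have := sh_sq (mem_PL.mp hp).1 (mem_SS.mp hr).1.1 hlr
      calc _ ≤ (wt ℓ p / p + 1 / (p:ℝ)^2) * (min (Real.log p) (ℓ - Real.log r))^2 := by gcongr
        _ = _ := by unfold wt; ring
    · have : 0 ≤ (wt ℓ p / p + 1 / (p:ℝ)^2) * (min (Real.log p) (ℓ - Real.log r))^2 := by positivity
      calc _ ≤ _ := this
        _ = _ := by unfold wt; ring

lemma WW_le (Z m : ℕ) (y : ℕ → ℝ) (ℓ T : ℝ) (hℓ : 0 ≤ ℓ) (hy : ∀ r, |y r| ≤ ℓ) 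
    (hT : ∀ r, 0 < r → r ≤ Z → (r.divisors.card : ℝ) ≤ T) : WW (SS Z m) y ≤ ℓ * T^2 * Z := by
  unfold WW
  calc _ ≤ ∑ r ∈ SS Z m, ℓ * T^2 := by
        apply Finset.sum_le_sum
        intro r hr
        have h1 := (mem_SS.mp hr).1
        have hr0 : 0 < r := h1.1
        have hφ : (0:ℝ) < r.totient := by exact_mod_cast Nat.totient_pos.mpr hr0
        have ht := hT r h1.1 h1.2
        have h2 : ∑ d ∈ r.divisors, (d:ℝ) ≤ r.divisors.card * r := by
          rw [← nsmul_eq_mul]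
          apply Finset.sum_le_card_nsmul
          intro d hd
          exact_mod_cast Nat.divisor_le hd
        have h3 : (r:ℝ) ≤ r.totient * r.divisors.card := by exact_mod_cast le_totient_mul_card_divisors r hr0
        have hd0 : (0:ℝ) ≤ r.divisors.card := by positivity
        have h4 : ∑ d ∈ r.divisors, (d:ℝ) ≤ T^2 * r.totient := by
          calc _ ≤ _ := h2
            _ ≤ r.divisors.card * (r.totient * r.divisors.card) := by gcongr
            _ = (r.divisors.card:ℝ)^2 * r.totient := by ring
            _ ≤ _ := by gcongr
        calc |y r| / r.totient * ∑ d ∈ r.divisors, (d:ℝ) ≤ ℓ / r.totient * (T^2 * r.totient) := by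
              gcongr; exact hy r
          _ = _ := by field_simp
    _ = #(SS Z m) * (ℓ * T^2) := by simp
    _ ≤ Z * (ℓ * T^2) := by
        gcongr
        calc #(SS Z m) ≤ #(Icc 1 Z) := Finset.card_le_card (Finset.filter_subset _ _)
          _ = Z := by simp
    _ = _ := by ring

lemma gcd_sum (Z n : ℕ) (hn : 0 < n) : ∑ r ∈ Icc 1 Z, (Nat.gcd n r : ℝ) / r ≤ n.divisors.card * (1 + Real.log Z) := by
  have h1 : ∀ r ∈ Icc 1 Z, (Nat.gcd n r : ℝ) / r ≤ ∑ d ∈ n.divisors, if d ∣ r then (d:ℝ) / r else 0 := by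
    intro r hr
    have := Finset.single_le_sum (f := fun d : ℕ => if d ∣ r then (d:ℝ) / r else 0) (s := n.divisors)
      (fun d _ => by positivity) (Nat.mem_divisors.mpr ⟨Nat.gcd_dvd_left n r, hn.ne'⟩)
    simpa [Nat.gcd_dvd_right] using this
  refine (Finset.sum_le_sum h1).trans ?_
  rw [Finset.sum_comm, ← nsmul_eq_mul]
  apply Finset.sum_le_card_nsmul
  intro d hd
  have hd0 := Nat.pos_of_mem_divisors hd
  have hd0' : (d:ℝ) ≠ 0 := by exact_mod_cast hd0.ne'
  rw [← Finset.sum_filter, sum_filter_dvd Z d hd0]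
  have : ∀ k ∈ Icc 1 (Z / d), (d:ℝ) / ((d * k : ℕ) : ℝ) = ((k:ℝ))⁻¹ := by
    intro k hk
    have hk0 : (k:ℝ) ≠ 0 := by exact_mod_cast (show 0 < k from (mem_Icc.mp hk).1).ne'
    push_cast; field_simp
  rw [Finset.sum_congr rfl this]
  calc _ ≤ ∑ k ∈ Icc 1 Z, ((k:ℝ))⁻¹ := by
        apply Finset.sum_le_sum_of_subset_of_nonneg
        · exact Finset.Icc_subset_Icc le_rfl (Nat.div_le_self _ _)
        · intros; positivity
    _ ≤ _ := by
        have := harmonic_le_one_add_log Z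
        rw [harmonic_eq_sum_Icc] at this
        push_cast at this
        exact this

lemma VV_le (Z m n : ℕ) (hn : 0 < n) (y : ℕ → ℝ) (ℓ T : ℝ) (hℓ : 0 ≤ ℓ) (hy : ∀ r, |y r| ≤ ℓ) (hT0 : 0 ≤ T)
    (hT : ∀ r, 0 < r → r ≤ Z → (r.divisors.card : ℝ) ≤ T) : |VV (SS Z m) y n| ≤ ℓ * T * (n.divisors.card * (1 + Real.log Z)) := by
  unfold VV
  calc _ ≤ ∑ r ∈ SS Z m, |y r / r.totient * KK (Nat.gcd n r)| := Finset.abs_sum_le_sum_abs _ _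
    _ ≤ ∑ r ∈ SS Z m, ℓ * T * ((Nat.gcd n r : ℝ) / r) := by
      apply Finset.sum_le_sum
      intro r hr
      have h1 := (mem_SS.mp hr).1
      have hr0 : 0 < r := h1.1
      have hr0' : (0:ℝ) < r := by exact_mod_cast hr0
      have hφ : (0:ℝ) < r.totient := by exact_mod_cast Nat.totient_pos.mpr hr0
      have ht := hT r h1.1 h1.2
      have h3 : (r:ℝ) ≤ r.totient * r.divisors.card := by exact_mod_cast le_totient_mul_card_divisors r hr0
      have hK := abs_KK_le (Nat.gcd n r) (Nat.gcd_pos_of_pos_left r hn)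
      rw [abs_mul, abs_div, abs_of_pos hφ]
      have h4 : 1 / (r.totient:ℝ) ≤ T / r := by
        rw [div_le_div_iff₀ hφ hr0', one_mul]
        calc _ ≤ _ := h3
          _ ≤ r.totient * T := by gcongr
          _ = _ := by ring
      calc |y r| / r.totient * |KK (Nat.gcd n r)| ≤ ℓ / r.totient * (Nat.gcd n r : ℝ) := by
            gcongr; exact hy r
        _ = ℓ * (1 / (r.totient:ℝ)) * (Nat.gcd n r : ℝ) := by ring
        _ ≤ ℓ * (T / r) * (Nat.gcd n r : ℝ) := by gcongr
        _ = _ := by ring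
    _ ≤ ∑ r ∈ Icc 1 Z, ℓ * T * ((Nat.gcd n r : ℝ) / r) := by
      apply Finset.sum_le_sum_of_subset_of_nonneg
      · exact Finset.filter_subset _ _
      · intros; positivity
    _ ≤ _ := by
      rw [← Finset.mul_sum]
      gcongr
      exact gcd_sum Z n hn

lemma RR_le (Z m n : ℕ) (hn : 0 < n) (y : ℕ → ℝ) (P : Finset ℕ) (w : ℕ → ℝ) (hw : ∀ p ∈ P, 0 ≤ w p ∧ w p ≤ 1) (v : ℝ) 
    (hv : |VV (SS Z m) y n| ≤ v) : |RR Z m y P w n| ≤ v^2 * (1 + 2 * n.divisors.card) := by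
  unfold RR
  have h1 : ∀ p ∈ P, (w p * (if p ^ 1 ∣ n then 1 else 0) + (if p ^ 2 ∣ n then 1 else 0) : ℝ) ≤ if p ∣ n then 2 else 0 := by
    intro p hp
    have := hw p hp
    by_cases h : p ∣ n
    · simp only [pow_one, h, if_true]
      split_ifs <;> linarith
    · have : ¬ p^2 ∣ n := fun h' => h ((dvd_pow_self p (by norm_num)).trans h')
      simp [h, this]
  have h0 : ∀ p ∈ P, (0:ℝ) ≤ (w p * (if p ^ 1 ∣ n then 1 else 0) + (if p ^ 2 ∣ n then 1 else 0) : ℝ) := by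
    intro p hp
    have := (hw p hp).1
    positivity
  have h2 := Finset.sum_le_sum h1
  have h3 := Finset.sum_nonneg h0
  have h4 : ∑ p ∈ P, (if p ∣ n then (2:ℝ) else 0) ≤ 2 * n.divisors.card := by
    rw [← Finset.sum_filter, Finset.sum_const, nsmul_eq_mul, mul_comm]
    gcongr
    intro p hp
    exact Nat.mem_divisors.mpr ⟨(mem_filter.mp hp).2, hn.ne'⟩
  rw [abs_mul, abs_of_nonneg (sq_nonneg _), ← sq_abs]
  gcongr
  rw [abs_le]
  have : (0:ℝ) ≤ n.divisors.card := by positivity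
  constructor <;> linarith

/-- Positive weight forces at most four prime factors. -/
lemma few_primes (ℓ : ℝ) (hℓ : 0 < ℓ) (m Z n : ℕ) (hn : 0 < n) (hnm : Nat.Coprime n m) (y : ℕ → ℝ) 
    (hlog : Real.log n ≤ 14.4 * ℓ) (hpos : 0 < RR Z m y (PS ℓ m) (wt ℓ) n) : n.primeFactorsList.length ≤ 4 := by
  unfold RR at hpos
  have hpos2 := pos_of_mul_pos_right hpos (sq_nonneg _)
  set S : ℕ → ℝ := fun p => (wt ℓ p * (if p ^ 1 ∣ n then 1 else 0) + (if p ^ 2 ∣ n then 1 else 0)) with hS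
  have h0 : ∀ p ∈ PS ℓ m, (0:ℝ) ≤ S p := by
    intro p hp
    have := (wt_bounds hℓ (mem_filter.mp hp).1).1
    simp only [hS]
    positivity
  have hlt : ∑ p ∈ PS ℓ m, S p < 1 := by linarith
  -- small primes divide once
  have hPS : ∀ p ∈ n.primeFactors, Real.log p ≤ 4 * ℓ → p ∈ PS ℓ m := by
    intro p hp h
    refine mem_filter.mpr ⟨mem_PL.mpr ⟨Nat.prime_of_mem_primeFactors hp, h⟩, ?_⟩
    exact hnm.coprime_dvd_left (Nat.dvd_of_mem_primeFactors hp)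
  have honce : ∀ p ∈ n.primeFactors, Real.log p ≤ 4 * ℓ → n.factorization p = 1 := by
    intro p hp h
    have hpp := Nat.prime_of_mem_primeFactors hp
    have hge : 1 ≤ n.factorization p := (hpp.dvd_iff_one_le_factorization hn.ne').mp (Nat.dvd_of_mem_primeFactors hp)
    by_contra hne
    have h2 : 2 ≤ n.factorization p := by omega
    have hd : p^2 ∣ n := (hpp.pow_dvd_iff_le_factorization hn.ne').mpr h2
    have h3 := Finset.single_le_sum h0 (hPS p hp h)
    have h4 : 1 ≤ S p := by
      have := (wt_bounds hℓ (mem_filter.mp (hPS p hp h)).1).1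
      simp only [hS, hd, if_true]
      have : 0 ≤ wt ℓ p * (if p ^ 1 ∣ n then 1 else 0) := by positivity
      linarith
    linarith
  have hlogn : Real.log n = ∑ p ∈ n.primeFactors, (n.factorization p : ℝ) * Real.log p := by
    have := Nat.prod_factorization_pow_eq_self hn.ne'
    conv_lhs => rw [← this]
    rw [Finsupp.prod, Nat.cast_prod, Real.log_prod]
    · rw [Nat.support_factorization]
      apply Finset.sum_congr rfl
      intro p _
      rw [Nat.cast_pow, Real.log_pow]
    · intro p hp
      have := (Nat.prime_of_mem_primeFactors (by simpa using hp)).ne_zero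
      exact_mod_cast pow_ne_zero _ this
  have hΩ : (n.primeFactorsList.length : ℝ) = ∑ p ∈ n.primeFactors, (n.factorization p : ℝ) := by
    have h1 : ArithmeticFunction.cardFactors n = n.factorization.sum fun _ k => k := ArithmeticFunction.cardFactors_eq_sum_factorization
    rw [ArithmeticFunction.cardFactors_apply] at h1
    rw [h1, Finsupp.sum, Nat.support_factorization]
    push_cast; rfl
  have hterm : ∀ p ∈ n.primeFactors, (n.factorization p : ℝ) * (1 - Real.log p / (4*ℓ)) ≤ if Real.log p ≤ 4 * ℓ then 7/5 * S p else 0 := by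
    intro p hp
    have hpp := Nat.prime_of_mem_primeFactors hp
    split_ifs with h
    · rw [honce p hp h]
      have hd : p^1 ∣ n := by simpa using Nat.dvd_of_mem_primeFactors hp
      simp only [hS, hd, if_true, wt]
      have : (0:ℝ) ≤ if p ^ 2 ∣ n then 1 else 0 := by positivity
      push_cast
      linarith
    · have : 1 ≤ Real.log p / (4*ℓ) := by rw [le_div_iff₀ (by positivity)]; linarith
      apply mul_nonpos_of_nonneg_of_nonpos (by positivity) (by linarith)
  have hsum := Finset.sum_le_sum hterm
  rw [← Finset.sum_filter, ← Finset.mul_sum] at hsum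
  have hsub : ∑ p ∈ n.primeFactors.filter (fun p : ℕ => Real.log p ≤ 4 * ℓ), S p ≤ ∑ p ∈ PS ℓ m, S p := by
    apply Finset.sum_le_sum_of_subset_of_nonneg
    · intro p hp
      obtain ⟨h1, h2⟩ := mem_filter.mp hp
      exact hPS p h1 h2
    · intro p hp _; exact h0 p hp
  have e : ∑ p ∈ n.primeFactors, (n.factorization p : ℝ) * (1 - Real.log p / (4*ℓ)) = n.primeFactorsList.length - Real.log n / (4*ℓ) := by
    rw [hΩ, hlogn, Finset.sum_div, ← Finset.sum_sub_distrib]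
    apply Finset.sum_congr rfl; intros; ring
  rw [e] at hsum
  have h6 : Real.log n / (4*ℓ) ≤ 3.6 := by rw [div_le_iff₀ (by positivity)]; linarith
  have : (n.primeFactorsList.length : ℝ) < 5 := by linarith
  have : n.primeFactorsList.length < 5 := by exact_mod_cast this
  omega

end St18


namespace St18

open Finset

lemma conj_char {m : ℕ} [NeZero m] (χ : DirichletCharacter ℂ m) (a : ZMod m) (ha : IsUnit a) :
    (starRingEnd ℂ) (χ a) = χ a⁻¹ := by
  have h1 : (starRingEnd ℂ) (χ a) = χ⁻¹ a := MulChar.star_apply' χ a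
  have h2 : χ⁻¹ a * χ a = 1 := by
    rw [← MulChar.mul_apply, inv_mul_cancel, MulChar.one_apply ha]
  have h3 : χ a⁻¹ * χ a = 1 := by
    rw [← map_mul, ZMod.inv_mul_of_unit a ha, map_one]
  have h4 : χ a ≠ 0 := right_ne_zero_of_mul_eq_one h3
  rw [h1]
  exact mul_right_cancel₀ h4 (h2.trans h3.symm)

lemma conj_char_inv {m : ℕ} [NeZero m] (χ : DirichletCharacter ℂ m) (a : ZMod m) :
    (starRingEnd ℂ) (χ a) = χ⁻¹ a := MulChar.star_apply' χ a

lemma char_orth {m : ℕ} [NeZero m] (a b : ZMod m) :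
    ∑ χ : DirichletCharacter ℂ m, χ b * (starRingEnd ℂ) (χ a) = if IsUnit a ∧ a = b then (m.totient : ℂ) else 0 := by
  by_cases ha : IsUnit a
  · have := DirichletCharacter.sum_char_inv_mul_char_eq ℂ ha b
    simp only [ha, true_and]
    rw [← this]
    apply Finset.sum_congr rfl
    intro χ _
    rw [conj_char χ a ha, mul_comm]
  · simp only [ha, false_and, if_false]
    apply Finset.sum_eq_zero
    intro χ _
    rw [χ.map_nonunit ha]; simp

lemma planch {m : ℕ} [NeZero m] (x : ℕ) (hx : x < m) (f : ℕ → ℂ) :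
    ∑ χ : DirichletCharacter ℂ m, ‖∑ n ∈ Icc 1 x, f n * χ (n : ZMod m)‖^2 ≤ m.totient * ∑ n ∈ Icc 1 x, ‖f n‖^2 := by
  have h : ((∑ χ : DirichletCharacter ℂ m, ‖∑ n ∈ Icc 1 x, f n * χ (n : ZMod m)‖^2 : ℝ) : ℂ) = 
      ((∑ n ∈ Icc 1 x, ‖f n‖^2 * (if IsUnit (n : ZMod m) then (m.totient : ℝ) else 0) : ℝ) : ℂ) := by
    push_cast
    have e1 : ∀ χ : DirichletCharacter ℂ m, ((‖∑ n ∈ Icc 1 x, f n * χ (n : ZMod m)‖ : ℝ) : ℂ)^2 = 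
        ∑ n ∈ Icc 1 x, ∑ k ∈ Icc 1 x, (f n * (starRingEnd ℂ) (f k)) * (χ (n : ZMod m) * (starRingEnd ℂ) (χ (k : ZMod m))) := by
      intro χ
      rw [← Complex.mul_conj', map_sum, Finset.sum_mul_sum]
      apply Finset.sum_congr rfl; intro n _
      apply Finset.sum_congr rfl; intro k _
      rw [map_mul]; ring
    simp_rw [e1]
    rw [Finset.sum_comm]
    apply Finset.sum_congr rfl
    intro n hn
    rw [Finset.sum_comm]
    rw [Finset.sum_eq_single n]
    · rw [← Finset.mul_sum, char_orth, Complex.mul_conj']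
      simp only [and_true]
      split_ifs <;> simp
    · intro k hk hkn
      rw [← Finset.mul_sum, char_orth, if_neg, mul_zero]
      rintro ⟨_, h⟩
      rw [ZMod.natCast_eq_natCast_iff'] at h
      have h1 := (mem_Icc.mp hk).2
      have h2 := (mem_Icc.mp hn).2
      rw [Nat.mod_eq_of_lt (by omega), Nat.mod_eq_of_lt (by omega)] at h
      exact hkn h
    · intro h; exact absurd hn h
  have h' := Complex.ofReal_injective h
  rw [h', Finset.mul_sum]
  apply Finset.sum_le_sum
  intro n _
  rw [mul_comm]
  gcongr
  split_ifs
  · exact le_rfl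
  · positivity

lemma bombieri {m : ℕ} [NeZero m] (x : ℕ) (P : Finset ℕ) (hP : P ⊆ Icc 1 x) (X : Finset (DirichletCharacter ℂ m)) (B : ℝ)
    (hB : ∀ χ : DirichletCharacter ℂ m, χ ≠ 1 → ∀ N : ℕ, ‖∑ n ∈ Icc 1 N, χ (n : ZMod m)‖ ≤ B) (hB0 : 0 ≤ B) :
    ∑ χ ∈ X, ‖∑ p ∈ P, χ (p : ZMod m)‖^2 ≤ #P * (x + #X * B) := by
  set F : DirichletCharacter ℂ m → ℂ := fun χ => ∑ p ∈ P, χ (p : ZMod m) with hF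
  set S : ℝ := ∑ χ ∈ X, ‖F χ‖^2 with hS
  have hS0 : 0 ≤ S := by positivity
  set G : ℕ → ℂ := fun n => ∑ χ ∈ X, (starRingEnd ℂ) (F χ) * χ (n : ZMod m) with hG
  have e1 : (S : ℂ) = ∑ p ∈ P, G p := by
    rw [hS, hG]
    push_cast
    rw [Finset.sum_comm]
    apply Finset.sum_congr rfl
    intro χ _
    rw [← Finset.mul_sum, ← Complex.conj_mul']
  have h1 : S ≤ ∑ p ∈ P, 1 * ‖G p‖ := by
    simp only [one_mul]
    calc S = ‖(S:ℂ)‖ := by rw [Complex.norm_real, Real.norm_of_nonneg hS0]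
      _ ≤ _ := by rw [e1]; exact norm_sum_le _ _
  have h2 : S^2 ≤ #P * ∑ n ∈ Icc 1 x, ‖G n‖^2 := by
    calc S^2 ≤ (∑ p ∈ P, 1 * ‖G p‖)^2 := by gcongr
      _ ≤ (∑ p ∈ P, (1:ℝ)^2) * ∑ p ∈ P, ‖G p‖^2 := Finset.sum_mul_sq_le_sq_mul_sq _ _ _
      _ = #P * ∑ p ∈ P, ‖G p‖^2 := by simp
      _ ≤ _ := by
        gcongr
  have h3 : ∑ n ∈ Icc 1 x, ‖G n‖^2 ≤ S * (x + #X * B) := by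
    have e2 : ((∑ n ∈ Icc 1 x, ‖G n‖^2 : ℝ) : ℂ) = ∑ χ ∈ X, ∑ ψ ∈ X, ((starRingEnd ℂ) (F χ) * F ψ) * ∑ n ∈ Icc 1 x, (χ * ψ⁻¹) (n : ZMod m) := by
      push_cast
      have : ∀ n, ((‖G n‖ : ℝ) : ℂ)^2 = ∑ χ ∈ X, ∑ ψ ∈ X, ((starRingEnd ℂ) (F χ) * F ψ) * (χ * ψ⁻¹) (n : ZMod m) := by
        intro n
        rw [← Complex.mul_conj', hG]
        simp only [map_sum, map_mul, Complex.conj_conj]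
        rw [Finset.sum_mul_sum]
        apply Finset.sum_congr rfl; intro χ _
        apply Finset.sum_congr rfl; intro ψ _
        rw [MulChar.mul_apply, conj_char_inv]; ring
      simp_rw [this]
      rw [Finset.sum_comm]
      apply Finset.sum_congr rfl; intro χ _
      rw [Finset.sum_comm]
      apply Finset.sum_congr rfl; intro ψ _
      exact (Finset.mul_sum _ _ _).symm
    have hK : ∀ χ ψ : DirichletCharacter ℂ m, ‖∑ n ∈ Icc 1 x, (χ * ψ⁻¹) (n : ZMod m)‖ ≤ (if χ = ψ then (x:ℝ) else 0) + B := by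
      intro χ ψ
      split_ifs with h
      · calc _ ≤ ∑ n ∈ Icc 1 x, ‖(χ * ψ⁻¹) (n : ZMod m)‖ := norm_sum_le _ _
          _ ≤ ∑ n ∈ Icc 1 x, (1:ℝ) := Finset.sum_le_sum fun n _ => DirichletCharacter.norm_le_one _ _
          _ = x := by simp
          _ ≤ _ := by linarith
      · rw [zero_add]
        apply hB
        intro h'
        exact h (mul_inv_eq_one.mp h')
    have h4 : ∑ n ∈ Icc 1 x, ‖G n‖^2 ≤ ∑ χ ∈ X, ∑ ψ ∈ X, (‖F χ‖ * ‖F ψ‖) * ((if χ = ψ then (x:ℝ) else 0) + B) := by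
      have h0 : 0 ≤ ∑ n ∈ Icc 1 x, ‖G n‖^2 := by positivity
      calc _ = ‖((∑ n ∈ Icc 1 x, ‖G n‖^2 : ℝ) : ℂ)‖ := by rw [Complex.norm_real, Real.norm_of_nonneg h0]
        _ ≤ _ := by
          rw [e2]
          refine (norm_sum_le _ _).trans (Finset.sum_le_sum fun χ _ => ?_)
          refine (norm_sum_le _ _).trans (Finset.sum_le_sum fun ψ _ => ?_)
          rw [norm_mul, norm_mul, RCLike.norm_conj]
          gcongr
          exact hK χ ψ
    have h5 : ∑ χ ∈ X, ∑ ψ ∈ X, (‖F χ‖ * ‖F ψ‖) * ((if χ = ψ then (x:ℝ) else 0) + B) = x * S + B * (∑ χ ∈ X, 1 * ‖F χ‖)^2 := by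
      simp only [mul_add, Finset.sum_add_distrib, one_mul]
      congr 1
      · rw [hS, Finset.mul_sum]
        apply Finset.sum_congr rfl
        intro χ hχ
        simp [hχ]; ring
      · rw [sq, Finset.sum_mul_sum, Finset.mul_sum]
        apply Finset.sum_congr rfl; intro χ _
        rw [Finset.mul_sum]
        apply Finset.sum_congr rfl; intro ψ _
        ring
    have h6 : (∑ χ ∈ X, 1 * ‖F χ‖)^2 ≤ #X * S := by
      refine (Finset.sum_mul_sq_le_sq_mul_sq _ _ _).trans ?_
      simp [hS]
    rw [h5] at h4
    calc _ ≤ _ := h4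
      _ ≤ x * S + B * (#X * S) := by gcongr
      _ = _ := by ring
  rcases hS0.eq_or_lt with h | h
  · rw [← h]; positivity
  · have h7 : S * S ≤ S * (#P * (x + #X * B)) := by
      calc S * S = S^2 := by ring
        _ ≤ _ := h2
        _ ≤ #P * (S * (x + #X * B)) := by gcongr
        _ = _ := by ring
    exact le_of_mul_le_mul_left h7 h

lemma fourier {m : ℕ} [NeZero m] (x : ℕ) (hx : x < m) (P : Finset ℕ) (hP : P ⊆ Icc 1 x) (hPc : ∀ p ∈ P, Nat.Coprime p m)
    (r : ℕ → ℝ) (B R S2 γ : ℝ) (hB0 : 0 < B) (hγ0 : 0 ≤ γ) (hγ : γ^2 * #P = 2 * B) (hR0 : 0 ≤ R)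
    (hB : ∀ χ : DirichletCharacter ℂ m, χ ≠ 1 → ∀ N : ℕ, ‖∑ n ∈ Icc 1 N, χ (n : ZMod m)‖ ≤ B)
    (hR : ∀ χ : DirichletCharacter ℂ m, χ ≠ 1 → ‖∑ n ∈ Icc 1 x, χ (n : ZMod m) * (r n : ℂ)‖ ≤ R)
    (hS2 : ∑ n ∈ Icc 1 x, r n ^ 2 ≤ S2)
    (hmain : 2 * x * #P * R + γ * #P * (m.totient * Real.sqrt (#P * S2)) < 
       (#P : ℝ)^2 * ∑ n ∈ Icc 1 x, (if Nat.Coprime n m then (1:ℝ) else 0) * r n)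
    (a : ZMod m) (ha : IsUnit a) :
    ∃ p ∈ P, ∃ q ∈ P, ∃ n ∈ Icc 1 x, Nat.Coprime n m ∧ 0 < r n ∧ ((p * q * n : ℕ) : ZMod m) = a := by
  classical
  by_contra hno
  push Not at hno
  set F : DirichletCharacter ℂ m → ℂ := fun χ => ∑ p ∈ P, χ (p : ZMod m) with hF
  set H : DirichletCharacter ℂ m → ℂ := fun χ => ∑ n ∈ Icc 1 x, χ (n : ZMod m) * (r n : ℂ) with hH
  set N0 : ℝ := ∑ p ∈ P, ∑ q ∈ P, ∑ n ∈ Icc 1 x, r n * (if IsUnit a ∧ a = ((p * q * n : ℕ) : ZMod m) then (m.totient : ℝ) else 0) with hN0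
  have hN : N0 ≤ 0 := by
    apply Finset.sum_nonpos; intro p hp
    apply Finset.sum_nonpos; intro q hq
    apply Finset.sum_nonpos; intro n hn
    split_ifs with h
    · have hu : IsUnit ((p * q * n : ℕ) : ZMod m) := h.2 ▸ ha
      rw [ZMod.isUnit_iff_coprime] at hu
      have hc : Nat.Coprime n m := hu.coprime_dvd_left (dvd_mul_left _ _)
      have : r n ≤ 0 := by
        by_contra h'
        exact hno p hp q hq n hn hc (not_le.mp h') h.2.symm
      exact mul_nonpos_of_nonpos_of_nonneg this (by positivity)
    · simp
  have e1 : ∑ χ : DirichletCharacter ℂ m, (starRingEnd ℂ) (χ a) * (F χ * F χ * H χ) = (N0 : ℂ) := by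
    rw [hN0]; simp only [Complex.ofReal_sum, Complex.ofReal_mul]
    have : ∀ χ : DirichletCharacter ℂ m, (starRingEnd ℂ) (χ a) * (F χ * F χ * H χ) = 
       ∑ p ∈ P, ∑ q ∈ P, ∑ n ∈ Icc 1 x, (r n : ℂ) * (χ ((p * q * n : ℕ) : ZMod m) * (starRingEnd ℂ) (χ a)) := by
      intro χ
      simp only [hF, hH]
      rw [Finset.sum_mul_sum, Finset.sum_mul, Finset.mul_sum]
      apply Finset.sum_congr rfl; intro p _
      rw [Finset.sum_mul, Finset.mul_sum]
      apply Finset.sum_congr rfl; intro q _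
      rw [Finset.mul_sum, Finset.mul_sum]
      apply Finset.sum_congr rfl; intro n _
      push_cast
      rw [map_mul, map_mul]; ring
    simp_rw [this]
    rw [Finset.sum_comm]
    apply Finset.sum_congr rfl; intro p _
    rw [Finset.sum_comm]
    apply Finset.sum_congr rfl; intro q _
    rw [Finset.sum_comm]
    apply Finset.sum_congr rfl; intro n _
    rw [← Finset.mul_sum, char_orth]
    split_ifs <;> simp
  set M1 : ℝ := ∑ n ∈ Icc 1 x, (if Nat.Coprime n m then (1:ℝ) else 0) * r n with hM1
  have e2 : (starRingEnd ℂ) ((1 : DirichletCharacter ℂ m) a) * (F 1 * F 1 * H 1) = (((#P:ℝ)^2 * M1 : ℝ) : ℂ) := by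
    have f1 : F 1 = #P := by
      simp only [hF]
      rw [Finset.sum_congr rfl (fun p hp => MulChar.one_apply ((ZMod.isUnit_iff_coprime p m).mpr (hPc p hp)))]
      simp
    have f2 : H 1 = (M1 : ℂ) := by
      simp only [hH, hM1]
      push_cast
      apply Finset.sum_congr rfl
      intro n _
      by_cases h : Nat.Coprime n m
      · rw [MulChar.one_apply ((ZMod.isUnit_iff_coprime n m).mpr h), if_pos h]; simp
      · rw [MulChar.map_nonunit _ (fun h' => h ((ZMod.isUnit_iff_coprime n m).mp h')), if_neg h]; simp
    rw [f1, f2, MulChar.one_apply ha]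
    rw [map_one]; push_cast; ring
  rw [← Finset.add_sum_erase _ _ (Finset.mem_univ (1 : DirichletCharacter ℂ m)), e2] at e1
  set U := (Finset.univ : Finset (DirichletCharacter ℂ m)).erase 1 with hU
  have hle : (#P:ℝ)^2 * M1 ≤ ∑ χ ∈ U, ‖F χ‖^2 * ‖H χ‖ := by
    have e3 : ∑ χ ∈ U, (starRingEnd ℂ) (χ a) * (F χ * F χ * H χ) = ((N0 - (#P:ℝ)^2 * M1 : ℝ) : ℂ) := by
      push_cast at e1 ⊢
      rw [← e1]; ring
    have h1 : ‖((N0 - (#P:ℝ)^2 * M1 : ℝ) : ℂ)‖ ≤ ∑ χ ∈ U, ‖F χ‖^2 * ‖H χ‖ := by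
      rw [← e3]
      refine (norm_sum_le _ _).trans (Finset.sum_le_sum fun χ _ => ?_)
      rw [norm_mul, norm_mul, norm_mul, RCLike.norm_conj, ← sq]
      have := DirichletCharacter.norm_le_one χ a
      have h0 : 0 ≤ ‖F χ‖^2 * ‖H χ‖ := by positivity
      nlinarith
    rw [Complex.norm_real, Real.norm_eq_abs] at h1
    have := (abs_le.mp h1).1
    linarith
  -- split
  set X := U.filter (fun χ => γ * #P ≤ ‖F χ‖) with hX
  have hXU : ∀ χ ∈ U, χ ≠ 1 := fun χ h => Finset.ne_of_mem_erase h
  rw [← Finset.sum_filter_add_sum_filter_not U (fun χ => γ * #P ≤ ‖F χ‖)] at hle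
  have hb := bombieri x P hP X B hB hB0.le
  have hXB : #X * B ≤ x := by
    by_cases hP0 : (#P : ℝ) = 0
    · rw [hP0] at hγ; linarith
    have hPpos : (0:ℝ) < #P := lt_of_le_of_ne (by positivity) (Ne.symm hP0)
    have h1 : #X * (γ * #P)^2 ≤ ∑ χ ∈ X, ‖F χ‖^2 := by
      rw [← nsmul_eq_mul]
      apply Finset.card_nsmul_le_sum
      intro χ hχ
      have := (mem_filter.mp hχ).2
      gcongr
    have h2 : (#P:ℝ) * (#X * (2 * B)) ≤ #P * (x + #X * B) := by
      calc _ = #X * (γ * #P)^2 := by rw [← hγ]; ring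
        _ ≤ _ := h1
        _ ≤ _ := hb
    have := le_of_mul_le_mul_left h2 hPpos
    linarith
  have hpart1 : ∑ χ ∈ U with γ * #P ≤ ‖F χ‖, ‖F χ‖^2 * ‖H χ‖ ≤ 2 * x * #P * R := by
    calc _ ≤ ∑ χ ∈ X, ‖F χ‖^2 * R := by
          apply Finset.sum_le_sum
          intro χ hχ
          gcongr
          exact hR χ (hXU χ (mem_filter.mp hχ).1)
      _ = (∑ χ ∈ X, ‖F χ‖^2) * R := by rw [Finset.sum_mul]
      _ ≤ (#P * (x + #X * B)) * R := by gcongr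
      _ ≤ (#P * (x + x)) * R := by gcongr
      _ = _ := by ring
  have hF2 : ∑ χ : DirichletCharacter ℂ m, ‖F χ‖^2 ≤ m.totient * #P := by
    have := planch (m := m) x hx (fun n => if n ∈ P then 1 else 0)
    have e : ∀ χ : DirichletCharacter ℂ m, ∑ n ∈ Icc 1 x, (if n ∈ P then (1:ℂ) else 0) * χ (n : ZMod m) = F χ := by
      intro χ
      simp only [ite_mul, one_mul, zero_mul]
      rw [← Finset.sum_filter, Finset.filter_mem_eq_inter, Finset.inter_eq_right.mpr hP]
    simp_rw [e] at this
    refine this.trans (le_of_eq ?_)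
    congr 1
    have e' : ∀ n ∈ Icc 1 x, ‖(if n ∈ P then (1:ℂ) else 0)‖^2 = if n ∈ P then (1:ℝ) else 0 := by
      intro n _; split_ifs <;> simp
    rw [Finset.sum_congr rfl e', ← Finset.sum_filter, Finset.filter_mem_eq_inter, Finset.inter_eq_right.mpr hP]
    simp
  have hH2 : ∑ χ : DirichletCharacter ℂ m, ‖H χ‖^2 ≤ m.totient * S2 := by
    have := planch (m := m) x hx (fun n => (r n : ℂ))
    have e : ∀ χ : DirichletCharacter ℂ m, ∑ n ∈ Icc 1 x, (r n : ℂ) * χ (n : ZMod m) = H χ := by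
      intro χ; simp only [hH]; apply Finset.sum_congr rfl; intros; ring
    simp_rw [e] at this
    refine this.trans ?_
    gcongr
    refine le_trans (le_of_eq ?_) hS2
    apply Finset.sum_congr rfl
    intro n _
    rw [Complex.norm_real, Real.norm_eq_abs, sq_abs]
  have hS20 : 0 ≤ S2 := le_trans (by positivity) hS2
  have hcs : ∑ χ : DirichletCharacter ℂ m, ‖F χ‖ * ‖H χ‖ ≤ m.totient * Real.sqrt (#P * S2) := by
    have h1 := Finset.sum_mul_sq_le_sq_mul_sq (Finset.univ : Finset (DirichletCharacter ℂ m)) (fun χ => ‖F χ‖) (fun χ => ‖H χ‖)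
    have h2 : (∑ χ : DirichletCharacter ℂ m, ‖F χ‖ * ‖H χ‖)^2 ≤ (m.totient * Real.sqrt (#P * S2))^2 := by
      refine h1.trans ?_
      calc _ ≤ (m.totient * #P : ℝ) * (m.totient * S2) := by gcongr
        _ = _ := by rw [mul_pow, Real.sq_sqrt (by positivity)]; ring
    exact le_of_sq_le_sq h2 (by positivity)
  have hpart2 : ∑ χ ∈ U with ¬ γ * #P ≤ ‖F χ‖, ‖F χ‖^2 * ‖H χ‖ ≤ γ * #P * (m.totient * Real.sqrt (#P * S2)) := by
    calc _ ≤ ∑ χ ∈ U with ¬ γ * #P ≤ ‖F χ‖, γ * #P * (‖F χ‖ * ‖H χ‖) := by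
          apply Finset.sum_le_sum
          intro χ hχ
          have := (not_le.mp (mem_filter.mp hχ).2).le
          calc ‖F χ‖^2 * ‖H χ‖ = ‖F χ‖ * (‖F χ‖ * ‖H χ‖) := by ring
            _ ≤ _ := by gcongr
      _ ≤ ∑ χ : DirichletCharacter ℂ m, γ * #P * (‖F χ‖ * ‖H χ‖) := by
          apply Finset.sum_le_sum_of_subset_of_nonneg (Finset.subset_univ _)
          intros; positivity
      _ ≤ _ := by rw [← Finset.mul_sum]; gcongr
  linarith

end St18

namespace St18
open Finset

lemma growth (ℓ0 : ℝ) : ∃ M : ℕ, ∀ m : ℕ, M ≤ m → 1 ≤ m ∧ 100 ≤ (m:ℝ)^(1/10000:ℝ) ∧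
    (∀ n, 0 < n → n ≤ m → (n.divisors.card : ℝ) ≤ (m:ℝ)^(1/10000:ℝ)) ∧
    1 + Real.log m ≤ (m:ℝ)^(1/10000:ℝ) ∧ ℓ0 ≤ 0.06 * Real.log m := by
  obtain ⟨C, hC1, hC⟩ := divisor_bound (1/20000) (by norm_num)
  have t1 : Filter.Tendsto (fun m : ℕ => (m:ℝ)^(1/20000:ℝ)) Filter.atTop Filter.atTop :=
    (tendsto_rpow_atTop (by norm_num)).comp tendsto_natCast_atTop_atTop
  have t2 : Filter.Tendsto (fun m : ℕ => Real.log (m:ℝ)) Filter.atTop Filter.atTop :=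
    Real.tendsto_log_atTop.comp tendsto_natCast_atTop_atTop
  have t3 : ∀ᶠ m : ℕ in Filter.atTop, ‖Real.log (m:ℝ)‖ ≤ 1 * ‖(m:ℝ)^(1/20000:ℝ)‖ :=
    tendsto_natCast_atTop_atTop.eventually
      ((isLittleO_log_rpow_atTop (r := 1/20000) (by norm_num)).bound (by norm_num : (0:ℝ) < 1))
  have := ((t1.eventually_ge_atTop (C + 100)).and (t2.eventually_ge_atTop (ℓ0 / 0.06))).and
    (t3.and (Filter.eventually_ge_atTop 1))
  obtain ⟨M, hM⟩ := Filter.eventually_atTop.mp this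
  refine ⟨M, fun m hm => ?_⟩
  obtain ⟨⟨h1, h2⟩, h3, h4⟩ := hM m hm
  have hm0 : (0:ℝ) ≤ m := by positivity
  have hsq : (m:ℝ)^(1/10000:ℝ) = (m:ℝ)^(1/20000:ℝ) * (m:ℝ)^(1/20000:ℝ) := by
    rw [← Real.rpow_add (by exact_mod_cast h4)]; norm_num
  set v := (m:ℝ)^(1/20000:ℝ) with hv
  rw [hsq]
  refine ⟨h4, by nlinarith, ?_, ?_, ?_⟩
  · intro n hn hnm
    refine (hC n hn).trans ?_
    have : (n:ℝ)^(1/20000:ℝ) ≤ v := by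
      rw [hv]; apply Real.rpow_le_rpow (by positivity) (by exact_mod_cast hnm) (by norm_num)
    calc C * (n:ℝ)^(1/20000:ℝ) ≤ v * v := by
          apply mul_le_mul (by linarith) this (by positivity) (by linarith)
      _ = _ := rfl
  · have : Real.log m ≤ v := by
      have := (le_abs_self _).trans h3
      rwa [one_mul, Real.norm_of_nonneg (by linarith)] at this
    nlinarith
  · rw [div_le_iff₀ (by norm_num)] at h2; linarith

lemma prime_count (m x : ℕ) (u : ℝ) (hu : 100 ≤ u) (hxm : x < m) (hlog : 1 + Real.log m ≤ u)
    (hτ : (m.divisors.card : ℝ) ≤ u) (hx : u^8639 ≤ x) :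
    u^8637 ≤ (#((Icc 1 x).filter (fun p => p.Prime ∧ Nat.Coprime p m)) : ℝ) := by
  set P := (Icc 1 x).filter (fun p => p.Prime ∧ Nat.Coprime p m) with hP
  have h1 : Nat.primeCounting x ≤ #P + m.divisors.card := by
    rw [Nat.primeCounting, Nat.primeCounting', Nat.count_eq_card_filter_range]
    refine le_trans (Finset.card_le_card ?_) (Finset.card_union_le P m.divisors)
    intro p hp
    simp only [mem_filter, mem_range] at hp
    rw [mem_union]
    by_cases hc : Nat.Coprime p m
    · left; rw [hP, mem_filter, mem_Icc]; exact ⟨⟨hp.2.one_lt.le, by omega⟩, hp.2, hc⟩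
    · right
      rw [Nat.mem_divisors]
      refine ⟨?_, by omega⟩
      by_contra h
      exact hc ((Nat.Prime.coprime_iff_not_dvd hp.2).mpr h)
  have hu1 : (1:ℝ) ≤ u := by linarith
  have h0 := Chebyshev.pi_ge x
  have hbig : u ≤ u^8637 := le_self_pow₀ hu1 (by norm_num)
  have hx2 : (100:ℝ) ≤ x := by
    refine le_trans ?_ hx
    exact hu.trans (le_self_pow₀ hu1 (by norm_num))
  have hlx : Real.log x ≤ u := by
    have : Real.log x ≤ Real.log m := Real.log_le_log (by linarith) (by exact_mod_cast hxm.le)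
    linarith
  have hlx1 : Real.log (x+1) ≤ u := by
    have : Real.log (x+1) ≤ Real.log m := Real.log_le_log (by linarith) (by exact_mod_cast hxm)
    linarith
  have hlp : 0 < Real.log x := Real.log_pos (by linarith)
  rw [div_le_iff₀ hlp] at h0
  have hl2 := Real.log_two_gt_d9
  have h3 : (x:ℝ) * 0.5 - u ≤ Nat.primeCounting x * u := by
    calc (x:ℝ) * 0.5 - u ≤ x * Real.log 2 - Real.log (x+1) := by nlinarith
      _ ≤ _ := h0
      _ ≤ _ := by gcongr
  have h4 : (Nat.primeCounting x : ℝ) ≤ #P + u := by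
    have : (Nat.primeCounting x : ℝ) ≤ #P + m.divisors.card := by exact_mod_cast h1
    linarith
  have h5 : u^8639 = u^8637 * u * u := by rw [← pow_succ, ← pow_succ]
  have h6 : u^8637 * u * u * 0.5 - u ≤ (#P + u) * u := by nlinarith
  have h7 : u^8637 * u * 0.5 - 1 ≤ #P + u := by
    have : (u^8637 * u * 0.5 - 1) * u ≤ (#P + u) * u := by linarith
    exact le_of_mul_le_mul_right this (by linarith)
  nlinarith

/-- the final numerical inequality -/
lemma numeric (u x N γ R S2 M1 φ : ℝ) (hu : 100 ≤ u) (hx0 : 0 ≤ x) (hx : x ≤ u^8640) (hN : u^8637 ≤ N)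
    (hγ0 : 0 ≤ γ) (hγ : γ^2 * N = 2 * u^5003) (hR : R = u^8610) (hS2 : S2 = u^8660)
    (hφ0 : 0 ≤ φ) (hφ : φ ≤ u^10000) (hM1 : u^8637 ≤ M1) :
    2 * x * N * R + γ * N * (φ * Real.sqrt (N * S2)) < N^2 * M1 := by
  have hu1 : (1:ℝ) ≤ u := by linarith
  have hu0 : (0:ℝ) < u := by linarith
  have hN0 : 0 < N := lt_of_lt_of_le (by positivity) hN
  have hs : γ * Real.sqrt (N * S2) ≤ u^6832 := by
    have : γ * Real.sqrt (N * S2) = Real.sqrt (2 * u^5003 * u^8660) := by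
      rw [← hγ, ← hS2, mul_assoc, Real.sqrt_mul (sq_nonneg γ), Real.sqrt_sq hγ0]
    rw [this]
    apply Real.sqrt_le_iff.mpr
    refine ⟨by positivity, ?_⟩
    calc 2 * u^5003 * u^8660 ≤ u * u^5003 * u^8660 := by gcongr; linarith
      _ = u^13664 := by rw [← pow_succ', ← pow_add]
      _ = (u^6832)^2 := by rw [← pow_mul]
  have a1 : 2 * x * N * R ≤ N * u^17251 := by
    rw [hR]
    calc 2 * x * N * u^8610 ≤ u * u^8640 * N * u^8610 := by gcongr; linarith
      _ = N * (u * u^8640 * u^8610) := by ring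
      _ = _ := by rw [← pow_succ', ← pow_add]
  have a2 : γ * N * (φ * Real.sqrt (N * S2)) ≤ N * u^17251 := by
    calc γ * N * (φ * Real.sqrt (N * S2)) = N * (φ * (γ * Real.sqrt (N * S2))) := by ring
      _ ≤ N * (u^10000 * u^6832) := by gcongr
      _ = N * u^16832 := by rw [← pow_add]
      _ ≤ N * u^17251 := by gcongr; norm_num
  have a3 : N * u^17274 ≤ N^2 * M1 := by
    calc N * u^17274 = N * (u^8637 * u^8637) := by rw [← pow_add]
      _ ≤ N * (N * M1) := by gcongr
      _ = _ := by ring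
  have a4 : u^17252 ≤ u^17274 := pow_le_pow_right₀ hu1 (by norm_num)
  have a5 : u^17252 = u * u^17251 := by rw [← pow_succ']
  have a6 : 0 < u^17251 := by positivity
  have a7 : N * u^17251 + N * u^17251 < N * u^17274 := by
    rw [← mul_add]
    apply mul_lt_mul_of_pos_left _ hN0
    nlinarith
  linarith

set_option maxHeartbeats 4000000 in
lemma mainlem : ∃ M : ℕ, ∀ m : ℕ, M ≤ m → ∀ a : ZMod m, IsUnit a →
    ∃ p q n : ℕ, p.Prime ∧ q.Prime ∧ 0 < n ∧ n.primeFactorsList.length ≤ 4 ∧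
      (p:ℝ) ≤ (m:ℝ)^(0.864:ℝ) ∧ (q:ℝ) ≤ (m:ℝ)^(0.864:ℝ) ∧ (n:ℝ) ≤ (m:ℝ)^(0.864:ℝ) ∧
      ((p * q * n : ℕ) : ZMod m) = a := by
  obtain ⟨ℓ0, hℓ01, hQ⟩ := Q_bound
  obtain ⟨M, hM⟩ := growth ℓ0
  refine ⟨M, fun m hm a ha => ?_⟩
  obtain ⟨hm1, hu, hT, hlog, hℓ⟩ := hM m hm
  haveI : NeZero m := ⟨by omega⟩
  have hmpos : (0:ℝ) < m := by exact_mod_cast hm1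
  set u := (m:ℝ)^(1/10000:ℝ) with hudef
  have hu1 : (1:ℝ) ≤ u := by linarith
  have hu0 : (0:ℝ) < u := by linarith
  have hpow : ∀ (k : ℕ), u^k = (m:ℝ)^((k:ℝ)/10000) := by
    intro k
    rw [hudef, ← Real.rpow_natCast, ← Real.rpow_mul hmpos.le]
    congr 1; ring
  have hpm : u^10000 = (m:ℝ) := by rw [hpow]; norm_num
  have hp864 : u^8640 = (m:ℝ)^(0.864:ℝ) := by rw [hpow]; norm_num
  have hpsq : u^5000 = √(m:ℝ) := by rw [hpow, Real.sqrt_eq_rpow]; norm_num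
  set ℓ := 0.06 * Real.log m with hℓdef
  have hℓ1 : 1 ≤ ℓ := by linarith
  have hℓpos : 0 < ℓ := by linarith
  have hℓu : 1 + ℓ ≤ u := by
    have : 0 ≤ Real.log m := Real.log_nonneg (by exact_mod_cast hm1)
    rw [hℓdef]; linarith
  have hexp : Real.exp ℓ = u^600 := by
    rw [hpow, Real.rpow_def_of_pos hmpos]; congr 1; rw [hℓdef]; push_cast; ring
  have hexp4 : Real.exp (4*ℓ) = u^2400 := by
    rw [hpow, Real.rpow_def_of_pos hmpos]; congr 1; rw [hℓdef]; push_cast; ring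
  set Z := ⌊Real.exp ℓ⌋₊ with hZ
  set Y := ⌊Real.exp (4*ℓ)⌋₊ with hY
  have hZu : (Z:ℝ) ≤ u^600 := by rw [← hexp]; exact Nat.floor_le (Real.exp_pos _).le
  have hYu : (Y:ℝ) ≤ u^2400 := by rw [← hexp4]; exact Nat.floor_le (Real.exp_pos _).le
  have hZ1 : 1 ≤ Z := by
    rw [hZ, Nat.one_le_floor_iff]; exact Real.one_le_exp hℓpos.le
  have hZm : Z ≤ m := by
    have : (Z:ℝ) ≤ m := by
      rw [← hpm]; exact hZu.trans (pow_le_pow_right₀ hu1 (by norm_num))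
    exact_mod_cast this
  have hlogZ : 1 + Real.log Z ≤ u := by
    have : Real.log Z ≤ ℓ := by
      rw [Real.log_le_iff_le_exp (by exact_mod_cast hZ1)]
      exact Nat.floor_le (Real.exp_pos _).le
    linarith
  set x := ⌊u^8640⌋₊ with hxdef
  have hxu : (x:ℝ) ≤ u^8640 := Nat.floor_le (by positivity)
  have hxl : u^8639 ≤ (x:ℝ) := by
    have h1 : u^8640 < x + 1 := Nat.lt_floor_add_one _
    have h2 : u^8640 = u * u^8639 := by rw [← pow_succ']
    have h3 : (1:ℝ) ≤ u^8639 := one_le_pow₀ hu1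
    nlinarith
  have hxm : x < m := by
    have : (x:ℝ) < m := by
      rw [← hpm]; exact hxu.trans_lt (pow_lt_pow_right₀ (by linarith) (by norm_num))
    exact_mod_cast this
  set P := (Icc 1 x).filter (fun p => p.Prime ∧ Nat.Coprime p m) with hP
  have hN := prime_count m x u hu hxm hlog (hT m hm1 le_rfl) hxl
  rw [← hP] at hN
  have hNpos : (0:ℝ) < #P := lt_of_lt_of_le (by positivity) hN
  set r : ℕ → ℝ := fun n => RR Z m (yy ℓ) (PS ℓ m) (wt ℓ) n with hr
  -- properties of PS
  have hPS1 : ∀ p ∈ PS ℓ m, p.Prime ∧ Nat.Coprime p m := by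
    intro p hp
    rw [PS, mem_filter, mem_PL] at hp
    exact ⟨hp.1.1, hp.2⟩
  have hPS2 : PS ℓ m ⊆ Icc 1 Y := by
    intro p hp
    rw [PS, mem_filter, mem_PL] at hp
    have hp0 : 0 < p := hp.1.1.pos
    rw [mem_Icc]
    refine ⟨hp0, ?_⟩
    rw [hY]
    apply Nat.le_floor
    exact (Real.log_le_iff_le_exp (by exact_mod_cast hp0)).mp hp.1.2
  have hPS3 : ∀ p ∈ PS ℓ m, 0 ≤ wt ℓ p ∧ wt ℓ p ≤ 1 := by
    intro p hp
    rw [PS, mem_filter] at hp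
    exact wt_bounds hℓpos hp.1
  have hTZ : ∀ s, 0 < s → s ≤ Z → (s.divisors.card : ℝ) ≤ u := fun s h1 h2 => hT s h1 (h2.trans hZm)
  have hWW0 : ∀ y : ℕ → ℝ, 0 ≤ WW (SS Z m) y := by
    intro y; unfold WW; positivity
  have hWgen : ∀ y : ℕ → ℝ, (∀ s, |y s| ≤ ℓ) → WW (SS Z m) y ^ 2 ≤ u^1206 := by
    intro y hy
    have h1 := WW_le Z m y ℓ u hℓpos.le hy hTZ
    have h2 : WW (SS Z m) y ≤ u^603 := by
      calc _ ≤ _ := h1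
        _ ≤ u * u^2 * u^600 := by gcongr; linarith
        _ = u^603 := by rw [← pow_succ', ← pow_add]
    calc WW (SS Z m) y ^ 2 ≤ (u^603)^2 := by
          have := hWW0 y
          gcongr
      _ = u^1206 := by rw [← pow_mul]
  have hW0 := hWgen (yy ℓ) (yy_abs ℓ hℓpos.le)
  have hW1 : ∀ p ∈ PS ℓ m, WW (SS Z m) (sh p (yy ℓ))^2 ≤ u^1206 :=
    fun p _ => hWgen _ (sh_abs ℓ hℓpos.le p)
  have hY3 : (1 + 2 * (Y:ℝ)) ≤ u^2401 := by
    have h1 : (1:ℝ) ≤ u^2400 := one_le_pow₀ hu1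
    have h2 : u^2401 = u * u^2400 := by rw [← pow_succ']
    nlinarith
  have hB : ∀ χ : DirichletCharacter ℂ m, χ ≠ 1 → ∀ N : ℕ, ‖∑ n ∈ Icc 1 N, χ (n : ZMod m)‖ ≤ u^5003 := by
    intro χ hχ N
    refine (polya χ hχ N).trans ?_
    have h1 := hT m hm1 le_rfl
    have h0 : 0 ≤ Real.log m := Real.log_nonneg (by exact_mod_cast hm1)
    calc _ ≤ u^5000 * u^2 * u := by rw [← hpsq]; gcongr
      _ = u^5003 := by rw [← pow_add, ← pow_succ]
  have hR : ∀ χ : DirichletCharacter ℂ m, χ ≠ 1 → ‖∑ n ∈ Icc 1 x, χ (n : ZMod m) * (r n : ℂ)‖ ≤ u^8610 := by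
    intro χ hχ
    refine (RR_char Z m x Y (yy ℓ) (yy_zero ℓ) (PS ℓ m) (wt ℓ) hPS1 hPS2 hPS3 (u^1206) hW0 hW1 χ (u^5003) (hB χ hχ)).trans ?_
    calc _ ≤ u^2401 * (u^1206 * u^5003) := by gcongr
      _ = u^8610 := by rw [← pow_add, ← pow_add]
  have hrle : ∀ n ∈ Icc 1 x, r n ^ 2 ≤ u^20 := by
    intro n hn
    rw [mem_Icc] at hn
    have hn0 : 0 < n := hn.1
    have hτn := hT n hn0 (by omega)
    have hlZ0 : 0 ≤ Real.log Z := Real.log_nonneg (by exact_mod_cast hZ1)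
    have h1 := VV_le Z m n hn0 (yy ℓ) ℓ u hℓpos.le (yy_abs ℓ hℓpos.le) hu0.le hTZ
    have h2 : |VV (SS Z m) (yy ℓ) n| ≤ u^4 := by
      calc _ ≤ _ := h1
        _ ≤ u * u * (u * u) := by gcongr; linarith
        _ = u^4 := by ring
    have h3 := RR_le Z m n hn0 (yy ℓ) (PS ℓ m) (wt ℓ) hPS3 _ h2
    have h4 : |r n| ≤ u^10 := by
      calc _ ≤ _ := h3
        _ ≤ (u^4)^2 * (1 + 2 * u) := by gcongr
        _ ≤ (u^4)^2 * (u * u) := by gcongr; nlinarith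
        _ = u^10 := by ring
    calc r n ^ 2 = |r n|^2 := (sq_abs _).symm
      _ ≤ (u^10)^2 := by gcongr
      _ = u^20 := by rw [← pow_mul]
  have hS2 : ∑ n ∈ Icc 1 x, r n ^ 2 ≤ u^8660 := by
    calc _ ≤ ∑ n ∈ Icc 1 x, u^20 := Finset.sum_le_sum hrle
      _ = x * u^20 := by simp
      _ ≤ u^8640 * u^20 := by gcongr
      _ = _ := by rw [← pow_add]
  have hM1 : u^8637 ≤ ∑ n ∈ Icc 1 x, (if Nat.Coprime n m then (1:ℝ) else 0) * r n := by
    refine le_trans ?_ (RR_cop Z m x Y (yy ℓ) (yy_zero ℓ) (PS ℓ m) (wt ℓ) hPS1 hPS2 hPS3 (u^1206) hW0 hW1)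
    have hq := hQ ℓ hℓ m
    have hτm := hT m hm1 le_rfl
    have h1 : (1 + 2 * (Y:ℝ)) * (u^1206 * m.divisors.card) ≤ u^3608 := by
      calc (1 + 2 * (Y:ℝ)) * (u^1206 * m.divisors.card) ≤ u^2401 * (u^1206 * u) :=
            mul_le_mul hY3 (mul_le_mul_of_nonneg_left hτm (pow_nonneg hu0.le _))
              (mul_nonneg (pow_nonneg hu0.le _) (Nat.cast_nonneg _)) (pow_nonneg hu0.le _)
        _ = u^3608 := by rw [← pow_succ, ← pow_add]
    have h2 : u^8638 ≤ (m.totient / m * x : ℝ) := by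
      have h3 : (m:ℝ) ≤ m.totient * m.divisors.card := by
        exact_mod_cast le_totient_mul_card_divisors m hm1
      have h4 : (m:ℝ) ≤ m.totient * u := h3.trans (by gcongr)
      have h5 : 1 / u ≤ (m.totient / m : ℝ) := by
        rw [div_le_div_iff₀ hu0 hmpos]; linarith
      calc u^8638 = 1 / u * u^8639 := by
            rw [one_div, eq_inv_mul_iff_mul_eq₀ hu0.ne', ← pow_succ']
        _ ≤ _ := by gcongr
    have h6 : u^8638 ≤ (m.totient / m * x : ℝ) * (∑ r ∈ SS Z m, yy ℓ r^2/r.totient -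
        ∑ p ∈ PS ℓ m, (wt ℓ p/p+1/(p:ℝ)^2) * ∑ r ∈ SS Z m, sh p (yy ℓ) r^2/r.totient) := by
      calc u^8638 ≤ (m.totient / m * x : ℝ) * 1 := by rw [mul_one]; exact h2
        _ ≤ _ := by gcongr
    have h7 : u^3608 ≤ u^8637 := pow_le_pow_right₀ hu1 (by norm_num)
    have h8 : u^8638 = u * u^8637 := by rw [← pow_succ']
    have h9 : 0 < u^8637 := by positivity
    have h10 : u^8637 + u^3608 ≤ u^8638 := by nlinarith
    linarith
  set γ := Real.sqrt (2 * u^5003 / #P) with hγ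
  have hγ2 : γ^2 * #P = 2 * u^5003 := by
    rw [hγ, Real.sq_sqrt (by positivity)]; field_simp
  have hφ : (m.totient : ℝ) ≤ u^10000 := by
    rw [hpm]; exact_mod_cast Nat.totient_le m
  have hfin := numeric u x #P γ (u^8610) (u^8660) _ m.totient hu (by positivity) hxu hN
    (Real.sqrt_nonneg _) hγ2 rfl rfl (by positivity) hφ hM1
  obtain ⟨p, hp, q, hq, n, hn, hnc, hrn, heq⟩ := fourier x hxm P (Finset.filter_subset _ _)
    (fun p hp => (Finset.mem_filter.mp hp).2.2) r (u^5003) (u^8610) (u^8660) γ (by positivity)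
    (Real.sqrt_nonneg _) hγ2 (by positivity) hB hR hS2 hfin a ha
  rw [hP, mem_filter, mem_Icc] at hp hq
  rw [mem_Icc] at hn
  have hcast : ∀ t : ℕ, t ≤ x → (t:ℝ) ≤ (m:ℝ)^(0.864:ℝ) := by
    intro t ht
    rw [← hp864]
    exact le_trans (by exact_mod_cast ht) hxu
  refine ⟨p, q, n, hp.2.1, hq.2.1, hn.1, ?_, hcast p hp.1.2, hcast q hq.1.2, hcast n hn.2, heq⟩
  refine few_primes ℓ hℓpos m Z n hn.1 hnc (yy ℓ) ?_ hrn
  have h1 := Real.log_le_log (by exact_mod_cast hn.1) (hcast n hn.2)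
  rw [Real.log_rpow hmpos] at h1
  rw [hℓdef]; linarith
end St18

theorem stmt_18 :
    ∀ ε : ℝ, 0 < ε → ∃ M : ℕ, ∀ m : ℕ, M ≤ m → ∀ a : ℤ, Int.gcd a m = 1 →
      ∃ L : List ℕ, L.length ≤ 6 ∧
        (∀ q ∈ L, q.Prime ∧ (q : ℝ) ≤ (m : ℝ) ^ ((0.864 : ℝ) + ε)) ∧
        ((L.prod : ℕ) : ℤ) ≡ a [ZMOD (m : ℤ)] := by
  intro ε hε
  obtain ⟨M, hM⟩ := St18.mainlem
  refine ⟨M + 1, fun m hm a ha => ?_⟩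
  have hm1 : (1:ℝ) ≤ m := by exact_mod_cast (by omega : 1 ≤ m)
  have hunit : IsUnit (a : ZMod m) := by
    have := ZMod.coe_int_isUnit_iff_isCoprime a m
    rw [this]
    exact (Int.isCoprime_iff_gcd_eq_one.mpr ha).symm
  obtain ⟨p, q, n, hp, hq, hn, hlen, h1, h2, h3, heq⟩ := hM m (by omega) a hunit
  have hmono : (m:ℝ)^(0.864:ℝ) ≤ (m:ℝ)^((0.864:ℝ)+ε) :=
    Real.rpow_le_rpow_of_exponent_le hm1 (by linarith)
  refine ⟨p :: q :: n.primeFactorsList, ?_, ?_, ?_⟩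
  · simp only [List.length_cons]; omega
  · intro s hs
    rw [List.mem_cons, List.mem_cons] at hs
    rcases hs with rfl | rfl | hs
    · exact ⟨hp, h1.trans hmono⟩
    · exact ⟨hq, h2.trans hmono⟩
    · refine ⟨Nat.prime_of_mem_primeFactorsList hs, ?_⟩
      have h4 : s ≤ n := Nat.le_of_mem_primeFactorsList hs
      have h5 : (s:ℝ) ≤ n := by exact_mod_cast h4
      exact h5.trans (h3.trans hmono)
  · rw [← ZMod.intCast_eq_intCast_iff]
    rw [List.prod_cons, List.prod_cons, Nat.prod_primeFactorsList hn.ne', ← mul_assoc, ← heq]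
    push_cast
    rfl
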